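/- arXiv:2603.19447 — 8 statements merged into one kernel-verified Lean document; each statement's English description precedes it below -/
import Mathlib

section
/- Let t ≥ 1 and d ≥ 0 be integers and let G be a finite simple graph whose complement contains no K_{t,t} as a subgraph. Let X₁,…,X_t be pairwise disjoint sets of vertices of G, each of size at most d+1, and let X be a set of vertices containing X₁ ∪ … ∪ X_t. Define Y = { y ∈ V(G) \ X : for every i ∈ {1,…,t}, X_i is not contained in N_G(y) }. Then |Y| ≤ (t−1)·(d+1)^t. -/
/-- A graph `H` contains `K_{t,t}` as a subgraph: there are disjoint vertex sets
`A`, `B` of size `t` each, with every pair `{a,b}`, `a ∈ A`, `b ∈ B`, an edge of `H`. -/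
def ContainsKtt {V : Type*} (H : SimpleGraph V) (t : ℕ) : Prop :=
  ∃ A B : Finset V, Disjoint A B ∧ A.card = t ∧ B.card = t ∧
    ∀ a ∈ A, ∀ b ∈ B, H.Adj a b

/-- If the complement of `G` has no `K_{t,t}` subgraph, `X₁,…,X_t ⊆ X` are pairwise
disjoint sets of vertices of size at most `d+1`, then the set `Y` of vertices outside
`X` having, for every `i`, some non-neighbor in `X_i`, has size at most `(t-1)(d+1)^t`. -/
theorem sizeY_bound {V : Type*} [Fintype V] (t d : ℕ) (ht : 1 ≤ t)
    (G : SimpleGraph V) (hfree : ¬ ContainsKtt Gᶜ t)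
    (Xi : Fin t → Set V)
    (hdisj : Pairwise (Function.onFun Disjoint Xi))
    (hcard : ∀ i, (Xi i).ncard ≤ d + 1)
    (X : Set V) (hsub : ∀ i, Xi i ⊆ X) :
    {y : V | y ∉ X ∧ ∀ i : Fin t, ¬ Xi i ⊆ G.neighborSet y}.ncard ≤
      (t - 1) * (d + 1) ^ t := by
  classical
  set Y : Set V := {y : V | y ∉ X ∧ ∀ i : Fin t, ¬ Xi i ⊆ G.neighborSet y}
  have hex : ∀ y, ∃ g : Fin t → V, y ∈ Y → ∀ i, g i ∈ Xi i ∧ ¬ G.Adj y (g i) := by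
    intro y
    by_cases hy : y ∈ Y
    · choose g hg using fun i => Set.not_subset.mp (hy.2 i)
      exact ⟨g, fun _ => hg⟩
    · exact ⟨fun _ => y, fun h => absurd h hy⟩
  choose f hf using hex
  by_contra! hlt
  have hpi : (Fintype.piFinset fun i => (Xi i).toFinset).card ≤ (d + 1) ^ t := by
    rw [Fintype.card_piFinset]
    refine (Finset.prod_le_pow_card _ _ (d + 1) fun i _ => ?_).trans (by simp)
    rw [← Set.ncard_eq_toFinset_card']
    exact hcard i
  have hmul : (Fintype.piFinset fun i => (Xi i).toFinset).card * (t - 1) < Y.toFinset.card := by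
    rw [← Set.ncard_eq_toFinset_card', mul_comm]
    exact (Nat.mul_le_mul_left _ hpi).trans_lt hlt
  obtain ⟨p, hp, hfiber⟩ := Finset.exists_lt_card_fiber_of_mul_lt_card_of_maps_to
    (f := f) (fun y hy => Fintype.mem_piFinset.mpr fun i =>
      Set.mem_toFinset.mpr (hf y (Set.mem_toFinset.mp hy) i).1) hmul
  obtain ⟨B, hB, hBcard⟩ := Finset.exists_subset_card_eq
    (show t ≤ (Y.toFinset.filter fun y => f y = p).card by omega)
  have hpX : ∀ i, p i ∈ Xi i := fun i => Set.mem_toFinset.mp (Fintype.mem_piFinset.mp hp i)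
  have hBY : ∀ b ∈ B, b ∈ Y ∧ f b = p := fun b hb => by simpa using hB hb
  have hinj : Function.Injective p := fun i j hij => by
    by_contra hne
    exact Set.disjoint_left.mp (hdisj hne) (hpX i) (hij ▸ hpX j)
  have hne : ∀ i, ∀ b ∈ B, p i ≠ b := fun i b hb h =>
    (hBY b hb).1.1 (h ▸ hsub i (hpX i))
  refine hfree ⟨Finset.univ.image p, B, ?_, ?_, hBcard, ?_⟩
  · rw [Finset.disjoint_left]
    intro a ha hb
    obtain ⟨i, -, rfl⟩ := Finset.mem_image.mp ha
    exact hne i _ hb rfl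
  · simp [Finset.card_image_of_injective _ hinj]
  · intro a ha b hb
    obtain ⟨i, -, rfl⟩ := Finset.mem_image.mp ha
    obtain ⟨hbY, hfb⟩ := hBY b hb
    exact (SimpleGraph.compl_adj G _ _).mpr
      ⟨hne i b hb, fun hadj => (hf b hbY i).2 (hfb ▸ hadj.symm)⟩
end

section
/- Let d, t ≥ 1 be integers, G a graph on vertex set [n] and M a G-partial matrix. Suppose: (i) X ⊆ [n] is a clique of G and M[X] is d-embeddable; (ii) for every v ∈ [n] \ X, M[C_v] is d-embeddable, where C_v = {v} ∪ (N_G(v) ∩ X); (iii) X₁,…,X_t ⊆ X are pairwise disjoint and for each i ∈ {1,…,t} the set X_i is a d-metric basis of M[X \ (X₁ ∪ … ∪ X_{i−1})]; (iv) with Y = { y ∈ [n] \ X : for every i ∈ {1,…,t}, X_i is not contained in N_G(y) }, for each y ∈ Y the set Z_y is a d-metric basis of M[N_G(y) ∩ X]; (v) w ∈ X \ ((X₁ ∪ … ∪ X_t) ∪ ⋃_{y∈Y} Z_y). Then M is d-completable if and only if M − w is d-completable. -/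
/-- `M` is a `G`-partial matrix: the specified entries (those indexed by edges of `G`)
are symmetric and nonnegative, and the diagonal is zero.  Entries at non-edges are
unspecified (their values are irrelevant). -/
def IsPartialMatrix {V : Type*} (G : SimpleGraph V) (M : V → V → ℝ) : Prop :=
  (∀ i j, G.Adj i j → M i j = M j i) ∧ (∀ i j, G.Adj i j → 0 ≤ M i j) ∧
    (∀ i, M i i = 0)

/-- `q` is a realization of the principal submatrix `M[S]` in `ℝ^d`. -/
def IsRealizationOn {V : Type*} (d : ℕ) (M : V → V → ℝ) (S : Set V)
    (q : V → EuclideanSpace ℝ (Fin d)) : Prop :=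
  ∀ u ∈ S, ∀ v ∈ S, dist (q u) (q v) ^ 2 = M u v

/-- The principal submatrix `M[S]` is `d`-embeddable. -/
def IsEmbeddableOn {V : Type*} (d : ℕ) (M : V → V → ℝ) (S : Set V) : Prop :=
  ∃ q : V → EuclideanSpace ℝ (Fin d), IsRealizationOn d M S q

/-- `B` is a `d`-metric basis of `M[S]`: `M[S]` is `d`-embeddable and in every
realization of `M[S]` in `ℝ^d` the points indexed by `B` are affinely independent and
every point of the realization lies in their affine span. -/
def IsMetricBasisOn {V : Type*} (d : ℕ) (M : V → V → ℝ) (S B : Set V) : Prop :=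
  B ⊆ S ∧ IsEmbeddableOn d M S ∧
    ∀ q : V → EuclideanSpace ℝ (Fin d), IsRealizationOn d M S q →
      AffineIndependent ℝ (fun b : B => q ↑b) ∧
      ∀ v ∈ S, q v ∈ affineSpan ℝ (q '' B)

/-- The `G`-partial matrix `M`, restricted to the vertex set `S`, is `d`-completable:
there are points in `ℝ^d`, one per vertex, realizing all specified entries between
vertices of `S`. -/
def IsCompletableOn {V : Type*} (d : ℕ) (G : SimpleGraph V) (M : V → V → ℝ)
    (S : Set V) : Prop :=
  ∃ p : V → EuclideanSpace ℝ (Fin d), ∀ u ∈ S, ∀ v ∈ S, G.Adj u v →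
    dist (p u) (p v) ^ 2 = M u v

/-- The `G`-partial matrix `M` is `d`-completable. -/
def IsCompletable {V : Type*} (d : ℕ) (G : SimpleGraph V) (M : V → V → ℝ) : Prop :=
  IsCompletableOn d G M Set.univ

section CongruentFamilies

variable {ι E : Type*} [NormedAddCommGroup E] [InnerProductSpace ℝ E]

/-- A point of an affine span is determined by its distances to the spanning points. -/
theorem eq_of_mem_affineSpan_of_dist_eq {s : Set E} {x y : E} (hy : y ∈ affineSpan ℝ s)
    (h : ∀ z ∈ s, dist z x = dist z y) : x = y := by
  have hle : affineSpan ℝ s ≤ AffineSubspace.perpBisector x y :=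
    affineSpan_le.2 fun z hz => AffineSubspace.mem_perpBisector_iff_dist_eq.2 (h z hz)
  have hxy := AffineSubspace.mem_perpBisector_iff_dist_eq.1 (hle hy)
  rw [dist_self, dist_eq_zero] at hxy
  exact hxy.symm

variable [FiniteDimensional ℝ E]

/-- Families of vectors with the same Gram matrix differ by a linear isometry. -/
theorem exists_linearIsometry_of_inner_eq {a b : ι → E}
    (h : ∀ i j, inner ℝ (a i) (a j) = inner ℝ (b i) (b j)) :
    ∃ L : E →ₗᵢ[ℝ] E, ∀ i, L (a i) = b i := by
  set A := Finsupp.linearCombination ℝ a with hA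
  set B := Finsupp.linearCombination ℝ b with hB
  have hnorm (c : ι →₀ ℝ) : ‖A c‖ = ‖B c‖ := by
    have hsq : inner ℝ (A c) (A c) = inner ℝ (B c) (B c) := by
      simp only [hA, hB, Finsupp.linearCombination_apply, Finsupp.sum, sum_inner, inner_sum,
        real_inner_smul_left, real_inner_smul_right, h]
    rw [real_inner_self_eq_norm_sq, real_inner_self_eq_norm_sq] at hsq
    exact (sq_eq_sq₀ (norm_nonneg _) (norm_nonneg _)).1 hsq
  obtain ⟨s, hs⟩ := A.rangeRestrict.exists_rightInverse_of_surjective A.range_rangeRestrict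
  have hAs (x : LinearMap.range A) : A (s x) = x :=
    congrArg Subtype.val (LinearMap.congr_fun hs x)
  let L : LinearMap.range A →ₗᵢ[ℝ] E :=
    { toLinearMap := B ∘ₗ s
      norm_map' := fun x => by simp [← hnorm, hAs] }
  refine ⟨L.extend, fun i => ?_⟩
  have hAi : A (Finsupp.single i 1) = a i := by simp [hA]
  have hBi : B (Finsupp.single i 1) = b i := by simp [hB]
  let x : LinearMap.range A := ⟨a i, _, hAi⟩
  have hx : B (s x - Finsupp.single i 1) = 0 := by
    rw [← norm_eq_zero, ← hnorm, map_sub, hAs, hAi, sub_self, norm_zero]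
  rw [map_sub, hBi, sub_eq_zero] at hx
  exact (L.extend_apply x).trans hx

/-- Congruent families of points differ by an isometry of the ambient space. -/
theorem exists_isometry_of_dist_eq {q p : ι → E}
    (h : ∀ i j, dist (q i) (q j) = dist (p i) (p j)) :
    ∃ T : E → E, Isometry T ∧ ∀ i, T (q i) = p i := by
  rcases isEmpty_or_nonempty ι with hι | ⟨⟨o⟩⟩
  · exact ⟨id, isometry_id, fun i => hι.elim i⟩
  · obtain ⟨L, hL⟩ := exists_linearIsometry_of_inner_eq
      (a := fun i => q i - q o) (b := fun i => p i - p o) fun i j => by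
        simp_rw [real_inner_eq_norm_mul_self_add_norm_mul_self_sub_norm_sub_mul_self_div_two,
          sub_sub_sub_cancel_right, ← dist_eq_norm, h]
    refine ⟨fun x => L (x - q o) + p o, Isometry.of_dist_eq fun x y => ?_, fun i => ?_⟩
    · rw [dist_add_right, L.dist_map, dist_sub_right]
    · simp [hL]

/-- Set-indexed form of `exists_isometry_of_dist_eq`. -/
theorem exists_isometry_of_dist_eq_on {S : Set ι} {q p : ι → E}
    (h : ∀ i ∈ S, ∀ j ∈ S, dist (q i) (q j) = dist (p i) (p j)) :
    ∃ T : E → E, Isometry T ∧ ∀ i ∈ S, T (q i) = p i := by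
  obtain ⟨T, hT, hTq⟩ := exists_isometry_of_dist_eq
    (q := fun i : S => q i) (p := fun i : S => p i) fun i j => h i i.2 j j.2
  exact ⟨T, hT, fun i hi => hTq ⟨i, hi⟩⟩

/-- If `p w` lies in the affine span of `p '' B`, then the distance from `p w` to `p v` is
determined by the distances among the points of `B`, from `v` to `B`, and from `w` to `B`. -/
theorem dist_eq_of_mem_affineSpan {r p : ι → E} {B : Set ι} {v w : ι}
    (hv : ∀ i ∈ insert v B, ∀ j ∈ insert v B, dist (r i) (r j) = dist (p i) (p j))
    (hw : ∀ b ∈ B, dist (r b) (r w) = dist (p b) (p w))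
    (hspan : p w ∈ affineSpan ℝ (p '' B)) :
    dist (r w) (r v) = dist (p w) (p v) := by
  obtain ⟨T, hT, hTr⟩ := exists_isometry_of_dist_eq_on hv
  have hTw : T (r w) = p w := by
    refine eq_of_mem_affineSpan_of_dist_eq hspan ?_
    rintro _ ⟨b, hb, rfl⟩
    rw [← hTr b (Set.mem_insert_of_mem v hb), hT.dist_eq, hw b hb,
      hTr b (Set.mem_insert_of_mem v hb)]
  rw [← hTw, ← hTr v (Set.mem_insert v B), hT.dist_eq]

end CongruentFamilies

/-- Two configurations with the same specified squared distance have the same distance. -/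
theorem dist_eq_dist_of_sq_eq {α β : Type*} [PseudoMetricSpace α] [PseudoMetricSpace β]
    {a b : α} {x y : β} {m : ℝ} (h : dist a b ^ 2 = m) (h' : dist x y ^ 2 = m) :
    dist a b = dist x y :=
  (sq_eq_sq₀ dist_nonneg dist_nonneg).1 (h.trans h'.symm)

section Realization

variable {V : Type*} {d : ℕ} {G : SimpleGraph V} {M : V → V → ℝ} {S T : Set V}
  {p q : V → EuclideanSpace ℝ (Fin d)}

theorem IsRealizationOn.mono (h : IsRealizationOn d M T p) (hST : S ⊆ T) :
    IsRealizationOn d M S p :=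
  fun u hu v hv => h u (hST hu) v (hST hv)

theorem IsRealizationOn.dist_eq (hq : IsRealizationOn d M S q) (hp : IsRealizationOn d M S p)
    {u v : V} (hu : u ∈ S) (hv : v ∈ S) : dist (q u) (q v) = dist (p u) (p v) :=
  dist_eq_dist_of_sq_eq (hq u hu v hv) (hp u hu v hv)

/-- A completion of `M - w` can be extended by a placement of `w` realizing all of a given
embeddable clique. -/
theorem exists_isRealizationOn_eq_off {X : Set V} (hdiag : ∀ i, M i i = 0) (hX : G.IsClique X)
    (hXemb : IsEmbeddableOn d M X) {w : V}
    (hp : ∀ u ∈ ({w}ᶜ : Set V), ∀ v ∈ ({w}ᶜ : Set V), G.Adj u v → dist (p u) (p v) ^ 2 = M u v) :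
    ∃ p', IsRealizationOn d M X p' ∧ ∀ u ≠ w, p' u = p u := by
  classical
  obtain ⟨q, hq⟩ := hXemb
  have hpX : IsRealizationOn d M (X \ {w}) p := by
    intro u hu v hv
    by_cases huv : u = v
    · simp [huv, hdiag]
    · exact hp u hu.2 v hv.2 (hX hu.1 hv.1 huv)
  obtain ⟨T, hT, hTq⟩ := exists_isometry_of_dist_eq_on (S := X \ {w}) (q := q) (p := p)
    fun i hi j hj => (hq.mono Set.sdiff_subset).dist_eq hpX hi hj
  have hupd : ∀ u ∈ X, Function.update p w (T (q w)) u = T (q u) := by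
    intro u hu
    by_cases huw : u = w
    · simp [huw]
    · rw [Function.update_of_ne huw, hTq u ⟨hu, huw⟩]
  refine ⟨_, fun u hu v hv => ?_, fun u hu => Function.update_of_ne hu (T (q w)) p⟩
  rw [hupd u hu, hupd v hv, hT.dist_eq, hq u hu v hv]

/-- If `C_v` is embeddable, `p` realizes `M[X]` and the edges from `v` to `B`, and `p w` is in the
affine span of `p '' B`, then `p` realizes the edge between `w` and `v`. -/
theorem dist_sq_eq_of_mem_affineSpan {X B : Set V} {v w : V} (hdiag : ∀ i, M i i = 0)
    (hsymm : ∀ i j, G.Adj i j → M i j = M j i)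
    (hCv : IsEmbeddableOn d M ({v} ∪ (G.neighborSet v ∩ X)))
    (hpX : IsRealizationOn d M X p) (hB : B ⊆ G.neighborSet v ∩ X)
    (hpB : ∀ b ∈ B, dist (p v) (p b) ^ 2 = M v b)
    (hw : w ∈ G.neighborSet v ∩ X) (hspan : p w ∈ affineSpan ℝ (p '' B)) :
    dist (p w) (p v) ^ 2 = M w v := by
  obtain ⟨r, hr⟩ := hCv
  have hrX : IsRealizationOn d M (G.neighborSet v ∩ X) r := hr.mono Set.subset_union_right
  have hpN : IsRealizationOn d M (G.neighborSet v ∩ X) p := hpX.mono Set.inter_subset_right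
  have hpC : IsRealizationOn d M (insert v B) p := by
    rintro i (rfl | hi) j (rfl | hj)
    · simp [hdiag]
    · exact hpB j hj
    · rw [dist_comm, hpB i hi, hsymm _ _ (hB hi).1]
    · exact hpN i (hB hi) j (hB hj)
  have hsub : insert v B ⊆ {v} ∪ (G.neighborSet v ∩ X) :=
    Set.insert_subset_insert hB
  have hdist := dist_eq_of_mem_affineSpan (r := r) (p := p)
    (fun i hi j hj => (hr.mono hsub).dist_eq hpC hi hj)
    (fun b hb => hrX.dist_eq hpN (hB hb) hw) hspan
  rw [← hdist]
  exact hr w (Or.inr hw) v (Or.inl rfl)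

end Realization

/-- Claim 3.2: the irrelevant-vertex claim in the `K_{t,t}`-free compression.
Deleting the vertex `w` (i.e. the row and column of `M` indexed by `w`) yields an
equivalent instance of `d`-EDM completion. -/
theorem irrelevant_vertex_Ktt {n : ℕ} (d t : ℕ) (hd : 1 ≤ d) (ht : 1 ≤ t)
    (G : SimpleGraph (Fin n)) (M : Fin n → Fin n → ℝ)
    (hM : IsPartialMatrix G M)
    (X : Set (Fin n)) (hX : G.IsClique X)
    (hXemb : IsEmbeddableOn d M X)
    (hCv : ∀ v : Fin n, v ∉ X → IsEmbeddableOn d M ({v} ∪ (G.neighborSet v ∩ X)))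
    (Xi : Fin t → Set (Fin n)) (hXisub : ∀ i, Xi i ⊆ X)
    (hXidisj : Pairwise (Function.onFun Disjoint Xi))
    (hXibasis : ∀ i : Fin t,
      IsMetricBasisOn d M (X \ ⋃ (j : Fin t) (_ : j < i), Xi j) (Xi i))
    (Y : Set (Fin n))
    (hY : Y = {y : Fin n | y ∉ X ∧ ∀ i : Fin t, ¬ Xi i ⊆ G.neighborSet y})
    (Z : Fin n → Set (Fin n))
    (hZ : ∀ y ∈ Y, IsMetricBasisOn d M (G.neighborSet y ∩ X) (Z y))
    (w : Fin n)
    (hw : w ∈ X \ ((⋃ i : Fin t, Xi i) ∪ ⋃ y ∈ Y, Z y)) :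
    IsCompletable d G M ↔ IsCompletableOn d G M {w}ᶜ := by
  constructor
  · rintro ⟨p, hp⟩
    exact ⟨p, fun u _ v _ => hp u trivial v trivial⟩
  rintro ⟨p₀, hp₀⟩
  obtain ⟨hsymm, -, hdiag⟩ := hM
  obtain ⟨hwX, hwN⟩ := hw
  simp only [Set.mem_union, Set.mem_iUnion, not_or, not_exists] at hwN
  obtain ⟨hwXi, hwZ⟩ := hwN
  obtain ⟨p, hpX, hpeq⟩ := exists_isRealizationOn_eq_off hdiag hX hXemb hp₀
  have hp : ∀ u, u ≠ w → ∀ v, v ≠ w → G.Adj u v → dist (p u) (p v) ^ 2 = M u v := by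
    intro u hu v hv huv
    rw [hpeq u hu, hpeq v hv]
    exact hp₀ u hu v hv huv
  have hpw : ∀ v, G.Adj v w → dist (p w) (p v) ^ 2 = M w v := by
    intro v hvw
    by_cases hvX : v ∈ X
    · exact hpX w hwX v hvX
    have hedge (B : Set (Fin n)) (hB : B ⊆ G.neighborSet v ∩ X) (hwB : w ∉ B)
        (hspan : p w ∈ affineSpan ℝ (p '' B)) : dist (p w) (p v) ^ 2 = M w v :=
      dist_sq_eq_of_mem_affineSpan hdiag hsymm (hCv v hvX) hpX hB
        (fun b hb => hp v hvw.ne b (fun h => hwB (h ▸ hb)) (hB hb).1) ⟨hvw, hwX⟩ hspan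
    by_cases hvY : v ∈ Y
    · obtain ⟨hZsub, -, hZspan⟩ := hZ v hvY
      exact hedge (Z v) hZsub (hwZ v hvY)
        ((hZspan p (hpX.mono Set.inter_subset_right)).2 w ⟨hvw, hwX⟩)
    · have hex : ∃ i, Xi i ⊆ G.neighborSet v := by
        by_contra! hno
        exact hvY (hY ▸ ⟨hvX, hno⟩)
      obtain ⟨i, hi⟩ := hex
      refine hedge (Xi i) (Set.subset_inter hi (hXisub i)) (hwXi i)
        (((hXibasis i).2.2 p (hpX.mono Set.sdiff_subset)).2 w ⟨hwX, ?_⟩)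
      simp only [Set.mem_iUnion, not_exists]
      exact fun j _ => hwXi j
  refine ⟨p, fun u _ v _ huv => ?_⟩
  by_cases hu : u = w
  · subst hu
    exact hpw v huv.symm
  by_cases hv : v = w
  · subst hv
    rw [dist_comm, hpw u huv, hsymm v u huv.symm]
  exact hp u hu v hv huv
end

section
/- (Irrelevant-vertex form of the compression theorem for K_{t,t}-free complements.) Let d ≥ 1 and t ≥ 2 be integers, let G be a graph on vertex set [n] that is not complete, whose complement Ḡ contains no K_{t,t} as a subgraph, and let M be a G-partial matrix. Set η = (d+1)·t + (t−1)·(d+1)^{t+1} + 1. If n ≥ C(2t + η − 2, 2t − 1) (a binomial coefficient), then there exists a vertex w ∈ [n] such that M is d-completable if and only if M − w is d-completable. -/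
open Finset in
/-- The distance between two affine combinations depends only on the pairwise distances of
the points that occur with nonzero weight. -/
theorem dist_affine_sum_eq_of_dist_eq {V E F : Type*} [Fintype V]
    [NormedAddCommGroup E] [InnerProductSpace ℝ E] [NormedAddCommGroup F] [InnerProductSpace ℝ F]
    {p : V → E} {r : V → F} {a b : V → ℝ} (ha : ∑ i, a i = 1) (hb : ∑ i, b i = 1) {T : Set V}
    (haT : ∀ i ∉ T, a i = 0) (hbT : ∀ i ∉ T, b i = 0)
    (h : ∀ i ∈ T, ∀ j ∈ T, dist (p i) (p j) = dist (r i) (r j)) :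
    dist (∑ i, a i • p i) (∑ i, b i • p i) = dist (∑ i, a i • r i) (∑ i, b i • r i) := by
  have h0 : ∑ i, (a i - b i) = 0 := by rw [sum_sub_distrib, ha, hb, sub_self]
  simp only [dist_eq_norm, ← sum_sub_distrib, ← sub_smul] at h ⊢
  rw [← sq_eq_sq₀ (norm_nonneg _) (norm_nonneg _), ← real_inner_self_eq_norm_sq,
    ← real_inner_self_eq_norm_sq, inner_sum_smul_sum_smul_of_sum_eq_zero _ h0 _ h0,
    inner_sum_smul_sum_smul_of_sum_eq_zero _ h0 _ h0]
  congr 2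
  refine sum_congr rfl fun i _ => sum_congr rfl fun j _ => ?_
  by_cases hi : i ∈ T
  · by_cases hj : j ∈ T
    · rw [h i hi j hj]
    · simp [haT j hj, hbT j hj]
  · simp [haT i hi, hbT i hi]

open Finset in
theorem exists_weights_of_mem_affineSpan_image {V E : Type*} [Fintype V]
    [NormedAddCommGroup E] [NormedSpace ℝ E] {q : V → E} {x : E} {C : Set V}
    (h : x ∈ affineSpan ℝ (q '' C)) :
    ∃ c : V → ℝ, (∀ i ∉ C, c i = 0) ∧ ∑ i, c i = 1 ∧ ∑ i, c i • q i = x := by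
  classical
  obtain ⟨s, w, hs, hw, rfl⟩ := eq_affineCombination_of_mem_affineSpan_image h
  refine ⟨fun i => if i ∈ s then w i else 0, fun i hi => if_neg fun his => hi (hs his), ?_, ?_⟩
  · simpa using hw
  · rw [affineCombination_eq_linear_combination _ _ _ hw]
    simp [ite_smul]

open Finset in
/-- A finite family of points in `ℝ^d` has a subfamily of at most `d + 1` points with the same
affine span. -/
theorem exists_subset_card_le_mem_affineSpan {V : Type*} {d : ℕ}
    (q : V → EuclideanSpace ℝ (Fin d)) (S : Finset V) :
    ∃ B ⊆ S, #B ≤ d + 1 ∧ ∀ v ∈ S, q v ∈ affineSpan ℝ (q '' B) := by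
  classical
  obtain ⟨t, hts, hspan, hind⟩ := exists_affineIndependent ℝ (V := EuclideanSpace ℝ (Fin d)) (q '' (S : Set V))
  have htf : t.Finite := (S.finite_toSet.image q).subset hts
  lift t to Finset (EuclideanSpace ℝ (Fin d)) using htf
  obtain ⟨B, hBS, hinj, rfl⟩ :=
    exists_subset_injOn_image_eq_of_surjOn (f := q) (S : Set V) t hts
  refine ⟨B, by exact_mod_cast hBS, ?_, fun v hv => ?_⟩
  · rw [← card_image_of_injOn hinj, ← Fintype.card_coe]
    refine hind.card_le_finrank_succ.trans ?_
    simpa using Submodule.finrank_le (vectorSpan ℝ (Set.range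
      (fun x : (B.image q : Set (EuclideanSpace ℝ (Fin d))) => (x : EuclideanSpace ℝ (Fin d)))))
  · rw [← coe_image, hspan]
    exact subset_affineSpan _ _ ⟨v, hv, rfl⟩

open Finset in
/-- Successively removing `k` affine bases from a finite family of points leaves a set of points
that is spanned by each of the removed bases. -/
theorem exists_disjoint_spanning_family {V : Type*} [DecidableEq V] {d : ℕ}
    (q : V → EuclideanSpace ℝ (Fin d)) (S : Finset V) (k : ℕ) :
    ∃ (B : ℕ → Finset V) (R : Finset V), R ⊆ S ∧ #S ≤ #R + k * (d + 1) ∧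
      (∀ i < k, B i ⊆ S ∧ Disjoint (B i) R ∧ #(B i) ≤ d + 1 ∧
        ∀ v ∈ R, q v ∈ affineSpan ℝ (q '' B i)) ∧
      ∀ i < k, ∀ j < k, i ≠ j → Disjoint (B i) (B j) := by
  induction k with
  | zero => exact ⟨fun _ => ∅, S, by simp⟩
  | succ k ih =>
    obtain ⟨B, R, hRS, hcard, hB, hdisj⟩ := ih
    obtain ⟨C, hCR, hC, hspan⟩ := exists_subset_card_le_mem_affineSpan q R
    refine ⟨fun i => if i < k then B i else C, R \ C, sdiff_subset.trans hRS, ?_, ?_, ?_⟩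
    · have := card_sdiff_add_card_eq_card hCR
      rw [add_one_mul]
      omega
    · intro i _
      by_cases hik : i < k
      · obtain ⟨h1, h2, h3, h4⟩ := hB i hik
        simp only [hik, if_true]
        exact ⟨h1, h2.mono_right sdiff_subset, h3, fun v hv => h4 v (sdiff_subset hv)⟩
      · simp only [hik, if_false]
        exact ⟨hCR.trans hRS, disjoint_sdiff, hC, fun v hv => hspan v (sdiff_subset hv)⟩
    · intro i hi j hj hij
      by_cases hik : i < k <;> by_cases hjk : j < k
      · simpa [hik, hjk] using hdisj i hik j hjk hij
      · simpa [hik, hjk] using (hB i hik).2.1.mono_right hCR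
      · simpa [hik, hjk] using ((hB j hjk).2.1.mono_right hCR).symm
      · omega

open Finset in
/-- The Erdős–Szekeres bound for two-colour Ramsey numbers. -/
theorem exists_isNClique_or_compl_isNClique {V : Type*} [DecidableEq V] (G : SimpleGraph V)
    (a b : ℕ) (U : Finset V) (hU : (a + b).choose a ≤ #U) :
    (∃ S ⊆ U, G.IsNClique (b + 1) S) ∨ ∃ S ⊆ U, Gᶜ.IsNClique (a + 1) S := by
  classical
  induction hm : a + b generalizing a b U with
  | zero =>
    obtain ⟨rfl, rfl⟩ : a = 0 ∧ b = 0 := by omega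
    obtain ⟨v, hv⟩ : U.Nonempty := card_pos.1 (by simpa using hU)
    exact .inl ⟨{v}, by simpa using hv, by simp [SimpleGraph.isNClique_iff]⟩
  | succ m ih =>
    obtain ⟨v, hv⟩ : U.Nonempty :=
      card_pos.1 ((Nat.choose_pos (Nat.le_add_right a b)).trans_le hU)
    rcases a with _ | a
    · exact .inr ⟨{v}, by simpa using hv, by simp [SimpleGraph.isNClique_iff]⟩
    rcases b with _ | b
    · exact .inl ⟨{v}, by simpa using hv, by simp [SimpleGraph.isNClique_iff]⟩
    set N := (U.erase v).filter (G.Adj v)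
    set N' := (U.erase v).filter (fun u => ¬ G.Adj v u)
    have hNU : N ⊆ U := (filter_subset _ _).trans (erase_subset _ _)
    have hNU' : N' ⊆ U := (filter_subset _ _).trans (erase_subset _ _)
    have hsum : #N + #N' + 1 = #U := by
      rw [card_filter_add_card_filter_not, card_erase_add_one hv]
    have hch : (a + 1 + (b + 1)).choose (a + 1) =
        (a + (b + 1)).choose a + (a + 1 + b).choose (a + 1) := by
      rw [show a + 1 + (b + 1) = (a + b + 1) + 1 by ring, Nat.choose_succ_succ,
        show a + (b + 1) = a + b + 1 by ring, show a + 1 + b = a + b + 1 by ring]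
    by_cases hN : (a + 1 + b).choose (a + 1) ≤ #N
    · rcases ih (a + 1) b N hN (by omega) with ⟨S, hSN, hS⟩ | ⟨S, hSN, hS⟩
      · exact .inl ⟨insert v S, insert_subset hv (hSN.trans hNU),
          hS.insert fun u hu => (mem_filter.1 (hSN hu)).2⟩
      · exact .inr ⟨S, hSN.trans hNU, hS⟩
    · rcases ih a (b + 1) N' (by omega) (by omega) with ⟨S, hSN, hS⟩ | ⟨S, hSN, hS⟩
      · exact .inl ⟨S, hSN.trans hNU', hS⟩
      · refine .inr ⟨insert v S, insert_subset hv (hSN.trans hNU'), hS.insert fun u hu => ?_⟩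
        obtain ⟨hu1, hu2⟩ := mem_filter.1 (hSN hu)
        exact (SimpleGraph.compl_adj G v u).2 ⟨(ne_of_mem_erase hu1).symm, hu2⟩

open Finset in
/-- In a `K_{t,t}`-free graph, few vertices have a neighbour in each of `t` disjoint small sets. -/
theorem card_le_of_not_containsKtt {V : Type*} [DecidableEq V] {H : SimpleGraph V}
    {t m : ℕ} (ht : 1 ≤ t) (hH : ¬ ContainsKtt H t) (B : ℕ → Finset V) (hB : ∀ i < t, #(B i) ≤ m)
    (hdisj : ∀ i < t, ∀ j < t, i ≠ j → Disjoint (B i) (B j)) (X : Finset V)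
    (hX : ∀ x ∈ X, ∀ i < t, ∃ b ∈ B i, H.Adj b x) :
    #X ≤ (t - 1) * m ^ t := by
  classical
  have hsub : X ⊆ (Fintype.piFinset fun i : Fin t => B i).biUnion
      fun f => X.filter fun x => ∀ i, H.Adj (f i) x := by
    intro x hx
    choose f hf hfx using fun i : Fin t => hX x hx i i.2
    exact mem_biUnion.2 ⟨f, Fintype.mem_piFinset.2 hf, mem_filter.2 ⟨hx, hfx⟩⟩
  refine (card_le_card hsub).trans ((card_biUnion_le_card_mul _ _ (t - 1) fun f hf => ?_).trans ?_)
  · by_contra! hcon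
    obtain ⟨Y, hY, hYcard⟩ := exists_subset_card_eq (n := t)
      (s := X.filter fun x => ∀ i, H.Adj (f i) x) (by omega)
    have hfinj : Function.Injective f := by
      intro i j hij
      by_contra hne
      rw [Fintype.mem_piFinset] at hf
      exact disjoint_left.1 (hdisj i i.2 j j.2 fun h => hne (Fin.ext h)) (hf i) (hij ▸ hf j)
    have hadj : ∀ a ∈ univ.image f, ∀ b ∈ Y, H.Adj a b := by
      intro a ha b hb
      obtain ⟨i, -, rfl⟩ := mem_image.1 ha
      exact (mem_filter.1 (hY hb)).2 i
    exact hH ⟨univ.image f, Y, disjoint_left.2 fun a ha haY => H.loopless.irrefl a (hadj a ha a haY),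
      by rw [card_image_of_injective _ hfinj, card_fin], hYcard, hadj⟩
  · rw [mul_comm, Fintype.card_piFinset]
    gcongr
    simpa using prod_le_pow_card univ (fun i : Fin t => #(B i)) m fun i _ => hB i i.2

open Finset in
theorem ContainsKtt.of_isNClique {V : Type*} [DecidableEq V] {H : SimpleGraph V} {t : ℕ}
    {S : Finset V} (hS : H.IsNClique (2 * t) S) : ContainsKtt H t := by
  obtain ⟨A, hAS, hA⟩ := exists_subset_card_eq (show t ≤ #S by have := hS.card_eq; omega)
  refine ⟨A, S \ A, disjoint_sdiff, hA, ?_, fun a ha b hb => ?_⟩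
  · rw [card_sdiff_of_subset hAS, hS.card_eq, hA]
    omega
  · rw [mem_sdiff] at hb
    exact hS.isClique (hAS ha) hb.1 fun h => hb.2 (h ▸ ha)

open Finset in
/-- A vertex `w` of a realized clique can be added to a completion of `M - w` if every neighbour
`v` of `w` sees a set of clique vertices that spans `w`, and the entry `M v w` is consistent with
some completion on that set together with `v` and `w`. -/
theorem IsCompletable.of_spanning_neighbors {V : Type*} [Fintype V] [DecidableEq V] {d : ℕ}
    {G : SimpleGraph V} {M : V → V → ℝ} (hM : IsPartialMatrix G M) {S : Set V} {w : V}
    (hwS : w ∈ S) (hclique : G.IsClique S) {q : V → EuclideanSpace ℝ (Fin d)}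
    (hq : IsRealizationOn d M S q) {C₀ : Set V} (hC₀S : C₀ ⊆ S) (hwC₀ : w ∉ C₀)
    (hC₀ : q w ∈ affineSpan ℝ (q '' C₀)) (hw : IsCompletableOn d G M {w}ᶜ)
    (h : ∀ v, G.Adj v w → ∃ C ⊆ S, w ∉ C ∧ (∀ c ∈ C, v ≠ c → G.Adj v c) ∧
      q w ∈ affineSpan ℝ (q '' C) ∧ IsCompletableOn d G M (insert v (insert w C))) :
    IsCompletable d G M := by
  have hdist : ∀ (T : Set V) (r₁ r₂ : V → EuclideanSpace ℝ (Fin d)),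
      (∀ i ∈ T, ∀ j ∈ T, i ≠ j → dist (r₁ i) (r₁ j) ^ 2 = M i j) →
      (∀ i ∈ T, ∀ j ∈ T, i ≠ j → dist (r₂ i) (r₂ j) ^ 2 = M i j) →
      ∀ i ∈ T, ∀ j ∈ T, dist (r₁ i) (r₁ j) = dist (r₂ i) (r₂ j) := by
    intro T r₁ r₂ h₁ h₂ i hi j hj
    by_cases hij : i = j
    · simp [hij]
    · rw [← sq_eq_sq₀ dist_nonneg dist_nonneg, h₁ i hi j hj hij, h₂ i hi j hj hij]
  obtain ⟨p, hp⟩ := hw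
  obtain ⟨a, haC, ha1, haq⟩ := exists_weights_of_mem_affineSpan_image hC₀
  have key : ∀ v, G.Adj v w → dist (p v) (∑ i, a i • p i) ^ 2 = M v w := by
    intro v hv
    obtain ⟨C, hCS, hwC, hCv, hC, r, hr⟩ := h v hv
    obtain ⟨c, hcC, hc1, hcq⟩ := exists_weights_of_mem_affineSpan_image hC
    have hvw : v ≠ w := hv.ne
    have single_sum : ∀ x : V, ∑ i, (Pi.single x 1 : V → ℝ) i = 1 := by simp
    have single_zero : ∀ (x : V) (T : Set V), x ∈ T → ∀ i ∉ T, (Pi.single x 1 : V → ℝ) i = 0 :=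
      fun x T hx i hi => Pi.single_eq_of_ne (fun hix : i = x => hi (hix ▸ hx)) 1
    have single_smul : ∀ (x : V) (f : V → EuclideanSpace ℝ (Fin d)),
        ∑ i, (Pi.single x 1 : V → ℝ) i • f i = f x := by
      simp [Pi.single_apply, ite_smul]
    have h1 : ∑ i, a i • p i = ∑ i, c i • p i := by
      rw [← dist_eq_zero, dist_affine_sum_eq_of_dist_eq (r := q) (T := C₀ ∪ C) ha1 hc1
        (fun i hi => haC i fun h => hi (.inl h)) (fun i hi => hcC i fun h => hi (.inr h)), haq, hcq,
        dist_self]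
      have hsub : C₀ ∪ C ⊆ S := Set.union_subset hC₀S hCS
      have hne : ∀ i ∈ C₀ ∪ C, i ≠ w := by
        rintro i (hi | hi) rfl
        exacts [hwC₀ hi, hwC hi]
      exact hdist _ _ _
        (fun i hi j hj hij => hp i (hne i hi) j (hne j hj) (hclique (hsub hi) (hsub hj) hij))
        (fun i hi j hj _ => hq i (hsub hi) j (hsub hj))
    have h2 : ∑ i, c i • r i = r w := by
      rw [← dist_eq_zero, ← single_smul w r, dist_affine_sum_eq_of_dist_eq (r := q)
        (T := insert w C) hc1 (single_sum w) (fun i hi => hcC i fun h => hi (.inr h))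
        (single_zero w _ (.inl rfl)), hcq, single_smul, dist_self]
      have hsub : insert w C ⊆ S := Set.insert_subset hwS hCS
      exact hdist _ _ _
        (fun i hi j hj hij => hr i (.inr hi) j (.inr hj) (hclique (hsub hi) (hsub hj) hij))
        (fun i hi j hj _ => hq i (hsub hi) j (hsub hj))
    have h3 : dist (p v) (∑ i, c i • p i) = dist (r v) (∑ i, c i • r i) := by
      rw [← single_smul v p, ← single_smul v r]
      refine dist_affine_sum_eq_of_dist_eq (T := insert v C) (single_sum v) hc1
        (single_zero v _ (.inl rfl)) (fun i hi => hcC i fun h => hi (.inr h)) ?_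
      have hadj : ∀ i ∈ insert v C, ∀ j ∈ insert v C, i ≠ j → G.Adj i j := by
        rintro i (rfl | hi) j (rfl | hj) hij
        · exact absurd rfl hij
        · exact hCv j hj hij
        · exact (hCv i hi hij.symm).symm
        · exact hclique (hCS hi) (hCS hj) hij
      have hne : ∀ i ∈ insert v C, i ≠ w := by
        rintro i (rfl | hi) rfl
        exacts [hvw rfl, hwC hi]
      have hsub : insert v C ⊆ insert v (insert w C) :=
        Set.insert_subset_insert (Set.subset_insert _ _)
      exact hdist _ _ _
        (fun i hi j hj hij => hp i (hne i hi) j (hne j hj) (hadj i hi j hj hij))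
        (fun i hi j hj hij => hr i (hsub hi) j (hsub hj) (hadj i hi j hj hij))
    rw [h1, h3, h2]
    exact hr v (.inl rfl) w (.inr (.inl rfl)) hv
  refine ⟨Function.update p w (∑ i, a i • p i), fun u _ v _ huv => ?_⟩
  by_cases hu : u = w
  · subst hu
    rw [Function.update_self, Function.update_of_ne huv.ne', dist_comm, key v huv.symm,
      hM.1 u v huv]
  · by_cases hv : v = w
    · subst hv
      rw [Function.update_self, Function.update_of_ne huv.ne, key u huv]
    · rw [Function.update_of_ne hu, Function.update_of_ne hv]
      exact hp u hu v hv huv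

open Finset in
/-- In a graph with `K_{t,t}`-free complement, a sufficiently large realized clique has a vertex
which is spanned, for each of its neighbours `v`, by at most `d + 1` other clique vertices
adjacent or equal to `v`. -/
theorem exists_vertex_spanned_by_neighbors {V : Type*} [Fintype V] [DecidableEq V] {d t : ℕ}
    (ht : 1 ≤ t) {G : SimpleGraph V} (hfree : ¬ ContainsKtt Gᶜ t)
    (q : V → EuclideanSpace ℝ (Fin d)) {S : Finset V}
    (hS : (d + 1) * t + (t - 1) * (d + 1) ^ (t + 1) < #S) :
    ∃ w ∈ S, (∃ C ⊆ S, w ∉ C ∧ q w ∈ affineSpan ℝ (q '' C)) ∧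
      ∀ v, G.Adj v w → ∃ C ⊆ S, #C ≤ d + 1 ∧ w ∉ C ∧ (∀ c ∈ C, v ≠ c → G.Adj v c) ∧
        q w ∈ affineSpan ℝ (q '' C) := by
  classical
  obtain ⟨B, R, hRS, hcard, hB, hdisj⟩ := exists_disjoint_spanning_family q S t
  set X : Finset V := univ.filter fun v => ∀ i < t, ∃ b ∈ B i, Gᶜ.Adj b v with hXdef
  have hX : #X ≤ (t - 1) * (d + 1) ^ t :=
    card_le_of_not_containsKtt ht hfree B (fun i hi => (hB i hi).2.2.1) hdisj X
      fun x hx => (mem_filter.1 hx).2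
  choose C hCsub hCcard hCspan using fun v : V =>
    exists_subset_card_le_mem_affineSpan q (R.filter (G.Adj v))
  have hU : #(X.biUnion C) ≤ (t - 1) * (d + 1) ^ (t + 1) := by
    refine (card_biUnion_le_card_mul _ _ _ fun v _ => hCcard v).trans ?_
    rw [pow_succ, ← mul_assoc]
    gcongr
  obtain ⟨w, hwR, hwU⟩ := exists_mem_notMem_of_card_lt_card
    (show #(X.biUnion C) < #R by rw [mul_comm t] at hcard; omega)
  have hgood : ∀ i < t, w ∉ B i := fun i hi hw => disjoint_left.1 (hB i hi).2.1 hw hwR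
  refine ⟨w, hRS hwR, ⟨B 0, (hB 0 ht).1, hgood 0 ht, (hB 0 ht).2.2.2 w hwR⟩, fun v hv => ?_⟩
  by_cases hvX : v ∈ X
  · exact ⟨C v, (hCsub v).trans ((filter_subset _ _).trans hRS), hCcard v,
      fun hw => hwU (mem_biUnion.2 ⟨v, hvX, hw⟩),
      fun c hc _ => (mem_filter.1 (hCsub v hc)).2, hCspan v w (mem_filter.2 ⟨hwR, hv⟩)⟩
  · simp only [hXdef, mem_filter, mem_univ, true_and, not_forall, not_exists, not_and] at hvX
    obtain ⟨i, hi, hiv⟩ := hvX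
    refine ⟨B i, (hB i hi).1, (hB i hi).2.2.1, hgood i hi, fun c hc hvc => ?_,
      (hB i hi).2.2.2 w hwR⟩
    by_contra hnadj
    exact hiv c hc ((SimpleGraph.compl_adj G c v).2 ⟨hvc.symm, fun hcv => hnadj hcv.symm⟩)

/-- Irrelevant-vertex form of the compression theorem for `K_{t,t}`-free complements:
if `G` is not complete, its complement has no `K_{t,t}` subgraph, and
`n ≥ C(2t + η − 2, 2t − 1)` where `η = (d+1)t + (t−1)(d+1)^{t+1} + 1`, then some
vertex `w` can be deleted from the `G`-partial matrix `M` without changing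
`d`-completability. -/
theorem irrelevant_vertex_exists_Ktt {n : ℕ} (d t : ℕ) (hd : 1 ≤ d) (ht : 2 ≤ t)
    (G : SimpleGraph (Fin n)) (hGnotcomplete : G ≠ ⊤)
    (hfree : ¬ ContainsKtt Gᶜ t)
    (M : Fin n → Fin n → ℝ) (hM : IsPartialMatrix G M)
    (hn : Nat.choose (2 * t + ((d + 1) * t + (t - 1) * (d + 1) ^ (t + 1) + 1) - 2)
        (2 * t - 1) ≤ n) :
    ∃ w : Fin n, (IsCompletable d G M ↔ IsCompletableOn d G M {w}ᶜ) := by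
  classical
  by_contra! hcon
  have hdel : ∀ w, IsCompletableOn d G M {w}ᶜ ∧ ¬ IsCompletable d G M := by
    intro w
    rcases hcon w with ⟨⟨p, hp⟩, h2⟩ | ⟨h1, h2⟩
    · exact absurd ⟨p, fun u _ v _ => hp u trivial v trivial⟩ h2
    · exact ⟨h2, h1⟩
  set k := (d + 1) * t + (t - 1) * (d + 1) ^ (t + 1) with hk
  obtain ⟨S, hS⟩ : ∃ S, G.IsNClique (k + 1) S := by
    rcases exists_isNClique_or_compl_isNClique G (2 * t - 1) k Finset.univ (by
      rw [Finset.card_fin, show 2 * t - 1 + k = 2 * t + (k + 1) - 2 by omega]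
      exact hn) with ⟨S, -, hS⟩ | ⟨S, -, hS⟩
    · exact ⟨S, hS⟩
    · rw [show 2 * t - 1 + 1 = 2 * t by omega] at hS
      exact absurd (ContainsKtt.of_isNClique hS) hfree
  obtain ⟨x, hx⟩ : ∃ x, x ∉ S := by
    by_contra! hall
    refine hGnotcomplete (SimpleGraph.ext ?_)
    ext u v
    exact ⟨fun h => h.ne, fun h => hS.isClique (hall u) (hall v) h⟩
  obtain ⟨q, hq⟩ := (hdel x).1
  have hqS : IsRealizationOn d M S q := by
    intro u hu v hv
    by_cases huv : u = v
    · simp [huv, hM.2.2 v]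
    · exact hq u (fun h => hx (h ▸ hu)) v (fun h => hx (h ▸ hv)) (hS.isClique hu hv huv)
  obtain ⟨w, hwS, ⟨C₀, hC₀S, hwC₀, hC₀⟩, hw⟩ :=
    exists_vertex_spanned_by_neighbors (by omega) hfree q (S := S) (by rw [hS.card_eq]; omega)
  refine (hdel w).2 (IsCompletable.of_spanning_neighbors hM (S := S) hwS hS.isClique hqS
    (C₀ := C₀) (by exact_mod_cast hC₀S) (by exact_mod_cast hwC₀) hC₀ (hdel w).1 fun v hv => ?_)
  obtain ⟨C, hCS, hCcard, hwC, hCv, hC⟩ := hw v hv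
  refine ⟨C, by exact_mod_cast hCS, by exact_mod_cast hwC, hCv, hC, ?_⟩
  have hbig : d + 3 < S.card := by
    have h1 : (d + 1) * 2 ≤ (d + 1) * t := by gcongr
    have h2 : 1 * (d + 1) ^ 1 ≤ (t - 1) * (d + 1) ^ (t + 1) := by
      gcongr <;> omega
    rw [hS.card_eq]
    omega
  obtain ⟨u, -, hu⟩ := Finset.exists_mem_notMem_of_card_lt_card
    (show (insert v (insert w C)).card < S.card from
      ((Finset.card_insert_le _ _).trans (Nat.succ_le_succ (Finset.card_insert_le _ _))).trans_lt
        (by omega))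
  obtain ⟨r, hr⟩ := (hdel u).1
  have hne : ∀ i ∈ (insert v (insert w C) : Set (Fin n)), i ≠ u := by
    rintro i hi rfl
    exact hu (by simpa using hi)
  exact ⟨r, fun i hi j hj => hr i (hne i hi) j (hne j hj)⟩
end

section
/- (Irrelevant-vertex form of the compression theorem for bounded-degree complements.) Let d ≥ 1 and Δ ≥ 0 be integers, let G be a graph on vertex set [n] that is not complete and whose complement Ḡ has maximum degree at most Δ, and let M be a G-partial matrix. If n > (d+1)·(Δ+1)², then there exists a vertex w ∈ [n] such that M is d-completable if and only if M − w is d-completable. -/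
open Finset in
/-- The distance from an affine combination of points to a further point is determined by the
mutual distances of all the points involved. -/
theorem dist_affineCombination_eq_of_dist_eq {ι V W P Q : Type*}
    [NormedAddCommGroup V] [InnerProductSpace ℝ V] [MetricSpace P] [NormedAddTorsor V P]
    [NormedAddCommGroup W] [InnerProductSpace ℝ W] [MetricSpace Q] [NormedAddTorsor W Q]
    {s : Finset ι} {a : ι → ℝ} (ha : ∑ i ∈ s, a i = 1) {p : ι → P} {q : ι → Q} {v : ι}
    (h : ∀ i ∈ s, ∀ j ∈ s, dist (p i) (p j) = dist (q i) (q j))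
    (hv : ∀ i ∈ s, dist (p i) (p v) = dist (q i) (q v)) :
    dist (s.affineCombination ℝ p a) (p v) = dist (s.affineCombination ℝ q a) (q v) := by
  classical
  set t := insert v s
  set b := Set.indicator (↑s) a
  have hst : s ⊆ t := subset_insert v s
  have hb : ∑ i ∈ t, b i = 1 := by
    rw [← ha]
    exact sum_indicator_subset a hst
  have hc : ∑ i ∈ t, (Pi.single v 1 : ι → ℝ) i = 1 := by
    simp [t]
  have ht : ∀ i ∈ t, ∀ j ∈ t, dist (p i) (p j) = dist (q i) (q j) := by
    intro i hi j hj
    rcases mem_insert.1 hi with rfl | his <;> rcases mem_insert.1 hj with rfl | hjs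
    · simp
    · rw [dist_comm, hv j hjs, dist_comm]
    · exact hv i his
    · exact h i his j hjs
  have hp := EuclideanGeometry.dist_affineCombination p hb hc
  have hq := EuclideanGeometry.dist_affineCombination q hb hc
  rw [affineCombination_indicator_subset a p hst, affineCombination_indicator_subset a q hst,
    ← affineCombination_piSingle ℝ t p (mem_insert_self v s),
    ← affineCombination_piSingle ℝ t q (mem_insert_self v s)]
  rw [← mul_self_inj dist_nonneg dist_nonneg, hp, hq]
  congr 2
  refine sum_congr rfl fun i hi => sum_congr rfl fun j hj => ?_
  rw [ht i hi j hj]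

open Finset in
/-- Every finite family of points has a subfamily of at most `dim + 1` points with the same affine
span. -/
theorem exists_subset_card_le_affineSpan_image_eq {ι V : Type*} [DecidableEq ι]
    [NormedAddCommGroup V] [InnerProductSpace ℝ V] [FiniteDimensional ℝ V]
    (q : ι → V) (t : Finset ι) :
    ∃ b ⊆ t, #b ≤ Module.finrank ℝ V + 1 ∧
      affineSpan ℝ (q '' b) = affineSpan ℝ (q '' t) := by
  classical
  obtain ⟨u, hut, hspan, hind⟩ := exists_affineIndependent ℝ V (q '' (t : Set ι))
  have hfin : u.Finite := (t.finite_toSet.image q).subset hut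
  lift u to Finset V using hfin
  obtain ⟨b, hbt, hinj, hbu⟩ := Finset.exists_subset_injOn_image_eq_of_surjOn _ u
    ((Set.surjOn_image q t).mono Set.Subset.rfl hut)
  refine ⟨b, mod_cast hbt, ?_, ?_⟩
  · have h := hind.card_le_finrank_succ
    rw [← card_image_of_injOn hinj, hbu]
    refine (Fintype.card_coe u).symm.le.trans (h.trans ?_)
    exact Nat.succ_le_succ (Submodule.finrank_le _)
  · rw [← hspan, ← hbu, coe_image]

open Finset in
/-- In a large finite family of points there is a point that remains in the affine span of the
others after removing any fewer than `k` points. -/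
theorem exists_mem_affineSpan_image_sdiff {ι V : Type*} [DecidableEq ι]
    [NormedAddCommGroup V] [InnerProductSpace ℝ V] [FiniteDimensional ℝ V]
    (q : ι → V) (k : ℕ) (t : Finset ι) (ht : k * (Module.finrank ℝ V + 1) < #t) :
    ∃ w ∈ t, ∀ s : Finset ι, #s < k →
      q w ∈ affineSpan ℝ (q '' ((t.erase w \ s : Finset ι) : Set ι)) := by
  induction k generalizing t with
  | zero =>
    obtain ⟨w, hw⟩ := card_pos.1 (by omega : 0 < #t)
    exact ⟨w, hw, by simp⟩
  | succ k ih =>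
    obtain ⟨b, hbt, hb, hspan⟩ := exists_subset_card_le_affineSpan_image_eq q t
    have hcard : k * (Module.finrank ℝ V + 1) < #(t \ b) := by
      rw [card_sdiff_of_subset hbt]
      rw [Nat.succ_mul] at ht
      omega
    obtain ⟨w, hw, hws⟩ := ih (t \ b) hcard
    rw [mem_sdiff] at hw
    refine ⟨w, hw.1, fun s hs => ?_⟩
    by_cases hsb : Disjoint s b
    · have hqw : q w ∈ affineSpan ℝ (q '' (b : Set ι)) := by
        rw [hspan]
        exact mem_affineSpan ℝ (Set.mem_image_of_mem q hw.1)
      refine affineSpan_mono ℝ (Set.image_mono ?_) hqw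
      intro i hi
      have hi' : i ∈ b := hi
      have his : i ∉ s := fun h => disjoint_left.1 hsb h hi'
      have hiw : i ≠ w := fun h => hw.2 (h ▸ hi')
      simp [his, hiw, hbt hi']
    · obtain ⟨j, hjs, hjb⟩ := not_disjoint_iff.1 hsb
      have hlt : #(s \ b) < #s :=
        card_lt_card ⟨sdiff_subset, fun h => (mem_sdiff.1 (h hjs)).2 hjb⟩
      refine affineSpan_mono ℝ (Set.image_mono ?_) (hws (s \ b) (by omega))
      intro i hi
      simp only [coe_sdiff, coe_erase, Set.mem_sdiff, mem_coe, Set.mem_singleton_iff] at hi ⊢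
      tauto

open Finset in
/-- If every vertex has at most `Δ` non-neighbours, then cliques of size `k + 1` exist among any
more than `k * (Δ + 1)` vertices. -/
theorem SimpleGraph.exists_isClique_of_compl_degree_le {V : Type*} [Fintype V] [DecidableEq V]
    {G : SimpleGraph V} {Δ : ℕ} (hdeg : ∀ v, (Gᶜ.neighborSet v).ncard ≤ Δ) (k : ℕ)
    (t : Finset V) (ht : k * (Δ + 1) < #t) :
    ∃ s ⊆ t, G.IsClique (s : Set V) ∧ #s = k + 1 := by
  classical
  induction k generalizing t with
  | zero =>
    obtain ⟨v, hv⟩ := card_pos.1 (by omega : 0 < #t)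
    exact ⟨{v}, by simpa using hv, by simp, by simp⟩
  | succ k ih =>
    obtain ⟨v, hv⟩ := card_pos.1 (by omega : 0 < #t)
    have hcov : t ⊆ t.filter (G.Adj v) ∪ insert v (Gᶜ.neighborFinset v) := by
      intro u hu
      simp only [mem_union, mem_filter, mem_insert, SimpleGraph.mem_neighborFinset,
        SimpleGraph.compl_adj]
      tauto
    have hd : #(Gᶜ.neighborFinset v) ≤ Δ := by
      rw [← Set.ncard_coe_finset, SimpleGraph.coe_neighborFinset]
      exact hdeg v
    have h1 := (card_le_card hcov).trans (card_union_le _ _)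
    have h2 := card_insert_le v (Gᶜ.neighborFinset v)
    rw [Nat.succ_mul] at ht
    obtain ⟨s, hst, hs, hsk⟩ := ih (t.filter (G.Adj v)) (by omega)
    have hadj : ∀ u ∈ s, G.Adj v u := fun u hu => (mem_filter.1 (hst hu)).2
    refine ⟨insert v s, ?_, ?_, ?_⟩
    · exact insert_subset hv (hst.trans (filter_subset _ _))
    · rw [coe_insert]
      exact hs.insert fun u hu _ => hadj u hu
    · rw [card_insert_of_notMem fun h => (hadj v h).ne rfl, hsk]

/-- If all one-vertex deletions of a partial matrix are completable and the graph is not complete,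
then every clique can be realized. -/
theorem exists_realization_of_isClique {V : Type*} {d : ℕ} {G : SimpleGraph V} (hG : G ≠ ⊤)
    {M : V → V → ℝ} (hM : ∀ w, IsCompletableOn d G M {w}ᶜ) {s : Set V} (hs : G.IsClique s) :
    ∃ q : V → EuclideanSpace ℝ (Fin d), ∀ u ∈ s, ∀ v ∈ s, u ≠ v →
      dist (q u) (q v) ^ 2 = M u v := by
  have hne : s ≠ Set.univ := by
    rintro rfl
    refine hG (top_le_iff.1 fun u v huv => hs (Set.mem_univ u) (Set.mem_univ v) huv)
  obtain ⟨x, hx⟩ := (Set.ne_univ_iff_exists_notMem s).1 hne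
  obtain ⟨q, hq⟩ := hM x
  exact ⟨q, fun u hu v hv huv =>
    hq u (fun h => hx (h ▸ hu)) v (fun h => hx (h ▸ hv)) (hs hu hv huv)⟩

open Finset in
/-- If all one-vertex deletions of a partial matrix are completable and `G` has a clique that is
large compared to the maximum degree of its complement, then the whole matrix is completable. -/
theorem isCompletable_of_forall_isCompletableOn_compl {V : Type*} [Fintype V] [DecidableEq V]
    {d Δ : ℕ} {G : SimpleGraph V} (hG : G ≠ ⊤) (hdeg : ∀ v, (Gᶜ.neighborSet v).ncard ≤ Δ)
    {M : V → V → ℝ} (hM : ∀ w, IsCompletableOn d G M {w}ᶜ) {t : Finset V}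
    (ht : G.IsClique (t : Set V)) (hcard : (Δ + 1) * (d + 1) < #t) :
    IsCompletable d G M := by
  classical
  obtain ⟨q, hq⟩ := exists_realization_of_isClique hG hM ht
  obtain ⟨w, hwt, hspan⟩ := exists_mem_affineSpan_image_sdiff q (Δ + 1) t (by simpa using hcard)
  obtain ⟨p, hp⟩ := hM w
  have hpq : ∀ u ∈ t.erase w, ∀ v ∈ t.erase w, dist (p u) (p v) = dist (q u) (q v) := by
    intro u hu v hv
    obtain ⟨huw, hut⟩ := mem_erase.1 hu
    obtain ⟨hvw, hvt⟩ := mem_erase.1 hv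
    rcases eq_or_ne u v with rfl | huv
    · simp
    · rw [← sq_eq_sq₀ dist_nonneg dist_nonneg, hq u hut v hvt huv, hp u huw v hvw (ht hut hvt huv)]
  obtain ⟨s₀, a₀, hs₀, ha₀, hqw⟩ :=
    eq_affineCombination_of_mem_affineSpan_image (hspan ∅ (by simp))
  rw [sdiff_empty, coe_subset] at hs₀
  set x := s₀.affineCombination ℝ p a₀
  have hxq : ∀ u ∈ t.erase w, dist x (p u) = dist (q w) (q u) := fun u hu => by
    rw [hqw]
    exact dist_affineCombination_eq_of_dist_eq ha₀ (fun i hi j hj => hpq i (hs₀ hi) j (hs₀ hj))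
      fun i hi => hpq i (hs₀ hi) u hu
  set p' := Function.update p w x
  have hp'w : p' w = x := Function.update_self ..
  have hp'ne : ∀ {u}, u ≠ w → p' u = p u := fun h => Function.update_of_ne h ..
  have hp'q : ∀ u ∈ t, ∀ v ∈ t, dist (p' u) (p' v) = dist (q u) (q v) := by
    intro u hu v hv
    rcases eq_or_ne u w with hu' | huw <;> rcases eq_or_ne v w with hv' | hvw
    · simp [hu', hv']
    · rw [hu', hp'w, hp'ne hvw, hxq v (mem_erase.2 ⟨hvw, hv⟩)]
    · rw [hv', hp'w, hp'ne huw, dist_comm, hxq u (mem_erase.2 ⟨huw, hu⟩), dist_comm]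
    · rw [hp'ne huw, hp'ne hvw, hpq u (mem_erase.2 ⟨huw, hu⟩) v (mem_erase.2 ⟨hvw, hv⟩)]
  have hw : ∀ v, G.Adj w v → dist (p' w) (p' v) ^ 2 = M w v ∧ dist (p' v) (p' w) ^ 2 = M v w := by
    intro v hwv
    by_cases hvt : v ∈ t
    · rw [hp'q w hwt v hvt, hp'q v hvt w hwt]
      exact ⟨hq w hwt v hvt hwv.ne, hq v hvt w hwt hwv.ne'⟩
    have hN : #(Gᶜ.neighborFinset v) < Δ + 1 := by
      rw [Nat.lt_succ_iff, ← Set.ncard_coe_finset, SimpleGraph.coe_neighborFinset]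
      exact hdeg v
    obtain ⟨s, a, hs, ha, hqs⟩ := eq_affineCombination_of_mem_affineSpan_image (hspan _ hN)
    rw [coe_subset] at hs
    have hst : ∀ i ∈ s, i ∈ t := fun i hi => mem_of_mem_erase (mem_sdiff.1 (hs hi)).1
    have hsw : ∀ i ∈ s, i ≠ w := fun i hi => ne_of_mem_erase (mem_sdiff.1 (hs hi)).1
    have hsv : ∀ i ∈ s, i ≠ v := fun i hi h => hvt (h ▸ hst i hi)
    have hadj : ∀ i ∈ s, G.Adj v i := fun i hi => by
      have h := (mem_sdiff.1 (hs hi)).2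
      rw [SimpleGraph.mem_neighborFinset, SimpleGraph.compl_adj] at h
      exact not_not.1 fun hn => h ⟨(hsv i hi).symm, hn⟩
    have hclique : G.IsClique (insert v (insert w (s : Set V))) := by
      refine (ht.subset ?_).insert ?_
      · exact Set.insert_subset hwt hst
      · rintro i (rfl | hi) _
        · exact hwv.symm
        · exact hadj i hi
    obtain ⟨r, hr⟩ := exists_realization_of_isClique hG hM hclique
    have hrq : ∀ u ∈ insert w s, ∀ u' ∈ insert w s, dist (r u) (r u') = dist (q u) (q u') := by
      intro u hu u' hu'
      have hmem : ∀ i ∈ insert w s, i ∈ t := fun i hi => by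
        rcases mem_insert.1 hi with rfl | hi
        exacts [hwt, hst i hi]
      rcases eq_or_ne u u' with rfl | hne
      · simp
      · rw [← sq_eq_sq₀ dist_nonneg dist_nonneg, hq u (hmem u hu) u' (hmem u' hu') hne]
        exact hr u (.inr (by simpa using hu)) u' (.inr (by simpa using hu')) hne
    have hcomb : ∀ f : V → EuclideanSpace ℝ (Fin d),
        (∀ u ∈ insert w s, ∀ u' ∈ insert w s, dist (f u) (f u') = dist (q u) (q u')) →
        f w = s.affineCombination ℝ f a := by
      intro f hf
      refine (dist_eq_zero.1 ?_).symm
      rw [dist_affineCombination_eq_of_dist_eq ha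
        (fun i hi j hj => hf i (mem_insert_of_mem hi) j (mem_insert_of_mem hj))
        fun i hi => hf i (mem_insert_of_mem hi) w (mem_insert_self w s), ← hqs, dist_self]
    have hp's : ∀ u ∈ insert w s, ∀ u' ∈ insert w s,
        dist (p' u) (p' u') = dist (q u) (q u') := by
      intro u hu u' hu'
      refine hp'q u ?_ u' ?_
      · rcases mem_insert.1 hu with rfl | hu
        exacts [hwt, hst u hu]
      · rcases mem_insert.1 hu' with rfl | hu'
        exacts [hwt, hst u' hu']
    have hrv : ∀ i ∈ s, dist (p' i) (p' v) = dist (r i) (r v) := by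
      intro i hi
      rw [hp'ne (hsw i hi), hp'ne hwv.ne', ← sq_eq_sq₀ dist_nonneg dist_nonneg,
        hr i (.inr (.inr hi)) v (.inl rfl) (hsv i hi)]
      exact hp i (hsw i hi) v hwv.ne' (hadj i hi).symm
    have key : dist (p' w) (p' v) = dist (r w) (r v) := by
      rw [hcomb p' hp's, hcomb r hrq]
      refine dist_affineCombination_eq_of_dist_eq ha (fun i hi j hj => ?_) hrv
      rw [hp's i (mem_insert_of_mem hi) j (mem_insert_of_mem hj),
        hrq i (mem_insert_of_mem hi) j (mem_insert_of_mem hj)]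
    constructor
    · rw [key]
      exact hr w (.inr (.inl rfl)) v (.inl rfl) hwv.ne
    · rw [dist_comm, key, dist_comm]
      exact hr v (.inl rfl) w (.inr (.inl rfl)) hwv.ne'
  refine ⟨p', fun u _ v _ huv => ?_⟩
  rcases eq_or_ne u w with rfl | huw
  · exact (hw v huv).1
  rcases eq_or_ne v w with rfl | hvw
  · exact (hw u huv.symm).2
  · rw [hp'ne huw, hp'ne hvw]
    exact hp u huw v hvw huv

/-- Irrelevant-vertex form of the compression theorem for bounded-degree complements:
if `G` is not complete, its complement has maximum degree at most `Δ`, and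
`n > (d+1)(Δ+1)²`, then some vertex `w` can be deleted from the `G`-partial matrix `M`
without changing `d`-completability. -/
theorem irrelevant_vertex_exists_maxDegree {n : ℕ} (d Δ : ℕ) (hd : 1 ≤ d)
    (G : SimpleGraph (Fin n)) (hGnotcomplete : G ≠ ⊤)
    (hdeg : ∀ v : Fin n, (Gᶜ.neighborSet v).ncard ≤ Δ)
    (M : Fin n → Fin n → ℝ) (hM : IsPartialMatrix G M)
    (hn : (d + 1) * (Δ + 1) ^ 2 < n) :
    ∃ w : Fin n, (IsCompletable d G M ↔ IsCompletableOn d G M {w}ᶜ) := by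
  by_contra! h
  have hne : ∀ w, ¬ IsCompletable d G M ∧ IsCompletableOn d G M {w}ᶜ := fun w => by
    have hmono : IsCompletable d G M → IsCompletableOn d G M {w}ᶜ := fun ⟨p, hp⟩ =>
      ⟨p, fun u _ v _ => hp u (Set.mem_univ u) v (Set.mem_univ v)⟩
    have := h w
    tauto
  obtain ⟨t, -, ht, hcard⟩ := SimpleGraph.exists_isClique_of_compl_degree_le hdeg
    ((Δ + 1) * (d + 1)) Finset.univ (by rw [Finset.card_univ, Fintype.card_fin]; linarith)
  exact (hne ⟨0, by omega⟩).1 (isCompletable_of_forall_isCompletableOn_compl hGnotcomplete hdeg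
    (fun w => (hne w).2) ht (by omega))
end

section
/- Let d, n ∈ ℕ, let p₁,…,pₙ be points of Euclidean space ℝ^d, and let M be the n×n matrix with M_{ij} = ‖p_i − p_j‖² (so M is a fully specified, d-embeddable Euclidean distance matrix). Let Y ⊆ [n] and let B ⊆ [n] \ Y be a d-metric basis of the principal submatrix M − Y obtained by deleting the rows and columns indexed by Y. Then there exists a d-metric basis B′ of M with B ⊆ B′. -/
/-- Affine independence of a family of points depends only on the pairwise distances. -/
theorem AffineIndependent.of_dist_eq {ι V W P Q : Type*}
    [NormedAddCommGroup V] [InnerProductSpace ℝ V] [MetricSpace P] [NormedAddTorsor V P]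
    [NormedAddCommGroup W] [InnerProductSpace ℝ W] [MetricSpace Q] [NormedAddTorsor W Q]
    {p : ι → P} {q : ι → Q} (hp : AffineIndependent ℝ p)
    (h : ∀ i j, dist (p i) (p j) = dist (q i) (q j)) : AffineIndependent ℝ q := by
  intro s w hw hs
  refine hp s w hw ?_
  rw [← inner_self_eq_zero (𝕜 := ℝ)] at hs ⊢
  rw [EuclideanGeometry.inner_weightedVSub _ hw _ hw] at hs ⊢
  simpa only [h] using hs

/-- Adjoining an index whose point lies outside the affine span of an affinely independent
subfamily yields an affinely independent subfamily. -/
theorem AffineIndependent.restrict_insert {ι k V P : Type*} [DivisionRing k] [AddCommGroup V]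
    [Module k V] [AddTorsor V P] {p : ι → P} {B : Set ι} {v : ι}
    (hB : AffineIndependent k fun b : B => p b) (hv : p v ∉ affineSpan k (p '' B)) :
    AffineIndependent k fun b : (insert v B : Set ι) => p b := by
  have hmem : ∀ y : {y : (insert v B : Set ι) // y ≠ ⟨v, Set.mem_insert v B⟩}, y.1.1 ∈ B :=
    fun y => y.1.2.resolve_left fun e => y.2 (Subtype.ext e)
  let f : {y : (insert v B : Set ι) // y ≠ ⟨v, Set.mem_insert v B⟩} ↪ B :=
    ⟨fun y => ⟨y.1.1, hmem y⟩, fun a b hab =>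
      Subtype.ext (Subtype.ext (Subtype.mk.inj hab))⟩
  refine AffineIndependent.affineIndependent_of_notMem_span (i := ⟨v, Set.mem_insert v B⟩)
    (hB.comp_embedding f) fun h => hv (affineSpan_mono k ?_ h)
  rintro _ ⟨x, hx, rfl⟩
  exact ⟨x, hmem ⟨x, hx⟩, rfl⟩

/-- Every `d`-metric basis of a principal submatrix `M − Y` of a fully specified
`d`-embeddable EDM `M` extends to a `d`-metric basis of `M`. -/
theorem metricBasis_extends {d n : ℕ} (p : Fin n → EuclideanSpace ℝ (Fin d))
    (M : Fin n → Fin n → ℝ)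
    (hM : ∀ i j, M i j = dist (p i) (p j) ^ 2)
    (Y : Set (Fin n)) (B : Set (Fin n)) (hB : B ⊆ Yᶜ)
    (hbasis : IsMetricBasisOn d M Yᶜ B) :
    ∃ B' : Set (Fin n), B ⊆ B' ∧ IsMetricBasisOn d M Set.univ B' := by
  obtain ⟨B', hBB', hmax⟩ :=
    (Set.toFinite {C : Set (Fin n) | AffineIndependent ℝ fun c : C => p c}).exists_le_maximal
      (hbasis.2.2 p fun u _ v _ => (hM u v).symm).1
  refine ⟨B', hBB', Set.subset_univ _, ⟨p, fun u _ v _ => (hM u v).symm⟩, fun q hq => ?_⟩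
  have hdist : ∀ u v, dist (p u) (p v) = dist (q u) (q v) := fun u v =>
    (sq_eq_sq₀ dist_nonneg dist_nonneg).1 ((hM u v).symm.trans (hq u trivial v trivial).symm)
  have hind : AffineIndependent ℝ fun b : B' => q b :=
    hmax.prop.of_dist_eq fun i j => hdist i j
  refine ⟨hind, fun v _ => ?_⟩
  by_contra hv
  have hins : AffineIndependent ℝ fun b : (insert v B' : Set (Fin n)) => p b :=
    (hind.restrict_insert hv).of_dist_eq fun i j => (hdist i j).symm
  exact hv (mem_affineSpan ℝ ⟨v, hmax.le_of_ge hins (Set.subset_insert v B')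
    (Set.mem_insert v B'), rfl⟩)
end

section
/- Let G be a finite connected simple graph on n ≥ 1 vertices, let w : E(G) → {1,2,3,4} be an edge weighting, let α be a real number with 0 < α < π/(2n), and let r > 0. Then there exists a map φ : V(G) → ℝ with |φ(u) − φ(v)| = w(uv) for every edge uv of G if and only if there exists a map ψ : V(G) → ℝ² with ‖ψ(u)‖ = r for every vertex u (all images lie on the circle of radius r centered at the origin) and ‖ψ(u) − ψ(v)‖ = 2r·sin(w(uv)·α/2) for every edge uv of G. -/
/-- On a tree, every antisymmetric function on the darts is the coboundary of a potential. -/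
theorem SimpleGraph.IsTree.exists_potential {V : Type*} {T : SimpleGraph V} (hT : T.IsTree)
    (s : V → V → ℝ) (hs : ∀ u v, T.Adj u v → s v u = -s u v) :
    ∃ φ : V → ℝ, ∀ u v, T.Adj u v → φ v - φ u = s u v := by
  obtain ⟨o⟩ := hT.connected.nonempty
  choose p hp _ using fun v => hT.existsUnique_path o v
  let φ : V → ℝ := fun v => ((p v).darts.map fun d => s d.fst d.snd).sum
  have step : ∀ u v (h : T.Adj u v), p v = (p u).concat h → φ v - φ u = s u v := by
    intro u v h e
    simp [φ, e, SimpleGraph.Walk.darts_concat]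
  refine ⟨φ, fun u v h => ?_⟩
  by_cases hu : u ∈ (p v).support
  · exact step u v h (hT.isAcyclic.path_concat (hp u) (hp v) h hu)
  · have hv : v ∈ (p u).support :=
      hT.isAcyclic.mem_support_of_ne_mem_support_of_adj_of_isPath (hp u) (hp v) h hu
    have := step v u h.symm (hT.isAcyclic.path_concat (hp v) (hp u) h.symm hv)
    linarith [hs u v h]

theorem SimpleGraph.Walk.abs_sub_le_mul_length {V : Type*} {G : SimpleGraph V} {φ : V → ℝ} {C : ℝ}
    (h : ∀ u v, G.Adj u v → |φ v - φ u| ≤ C) {u v : V} (p : G.Walk u v) :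
    |φ v - φ u| ≤ C * p.length := by
  induction p with
  | nil => simp
  | @cons a b c hab p ih =>
    have := abs_sub_le (φ c) (φ b) (φ a)
    have := h a b hab
    rw [SimpleGraph.Walk.length_cons]
    push_cast
    linarith

/-- The length of the chord subtending a central angle of `|a| ≤ 2π` in a circle. -/
theorem Complex.norm_sub_mul_exp_I (z : ℂ) {a : ℝ} (ha : |a| ≤ 2 * Real.pi) :
    ‖z - z * Complex.exp (Complex.I * a)‖ = 2 * ‖z‖ * Real.sin (|a| / 2) := by
  have h : 0 ≤ Real.sin (|a| / 2) :=
    Real.sin_nonneg_of_nonneg_of_le_pi (by positivity) (by linarith)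
  have h1 : ‖z - z * Complex.exp (Complex.I * a)‖ =
      ‖z‖ * ‖Complex.exp (Complex.I * a) - 1‖ := by
    rw [← norm_mul, ← norm_neg]
    congr 1
    ring
  have h2 : |Real.sin (a / 2)| = Real.sin (|a| / 2) := by
    rw [← abs_of_nonneg h]
    rcases abs_choice a with e | e <;> rw [e]
    rw [neg_div, Real.sin_neg, abs_neg]
  rw [h1, Complex.norm_exp_I_mul_ofReal_sub_one, norm_mul, Real.norm_eq_abs, Real.norm_eq_abs, h2]
  norm_num
  ring

/-- Lifting angles: if the points `z u` lie on a circle and adjacent points are at angles at most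
`C`, with `C · n < 2π`, then the angles along all edges come from a global potential. -/
theorem SimpleGraph.Connected.exists_angle_potential {V : Type*} [Fintype V] {G : SimpleGraph V}
    (hG : G.Connected) (z : V → ℂ) (a : V → V → ℝ) (C : ℝ)
    (hz : ∀ u, z u ≠ 0)
    (hza : ∀ u v, G.Adj u v → z v = z u * Complex.exp (Complex.I * a u v))
    (hanti : ∀ u v, G.Adj u v → a v u = -a u v)
    (haC : ∀ u v, G.Adj u v → |a u v| ≤ C)
    (hC : C * Fintype.card V < 2 * Real.pi) :
    ∃ φ : V → ℝ, ∀ u v, G.Adj u v → φ v - φ u = a u v := by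
  obtain ⟨T, hTG, hT⟩ := hG.exists_isTree_le
  obtain ⟨φ, hφ⟩ := hT.exists_potential a fun u v h => hanti u v (hTG h)
  refine ⟨φ, fun u v huv => ?_⟩
  have hexp : ∀ {x y : V} (_ : T.Walk x y),
      z y = z x * Complex.exp (Complex.I * ((φ y - φ x : ℝ) : ℂ)) := by
    intro x y p
    induction p with
    | nil => simp
    | @cons x b c hxb p ih =>
      rw [ih, hza x b (hTG hxb), ← hφ x b hxb, mul_assoc, ← Complex.exp_add]
      congr 2
      push_cast
      ring
  obtain ⟨p, hp, -⟩ := hT.existsUnique_path u v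
  have hlen : |φ v - φ u| ≤ C * p.length :=
    p.abs_sub_le_mul_length fun x y h => by rw [hφ x y h]; exact haC x y (hTG h)
  have hpl : (p.length : ℝ) + 1 ≤ Fintype.card V := by exact_mod_cast hp.length_lt
  have hC0 : 0 ≤ C := (abs_nonneg _).trans (haC u v huv)
  have hlt : |φ v - φ u - a u v| < 2 * Real.pi := by
    have := abs_sub (φ v - φ u) (a u v)
    have := haC u v huv
    nlinarith [mul_le_mul_of_nonneg_left hpl hC0]
  have heq := mul_left_cancel₀ (hz u) ((hexp p).symm.trans (hza u v huv))
  obtain ⟨k, hk⟩ := Complex.exp_eq_exp_iff_exists_int.1 heq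
  have hk' : φ v - φ u - a u v = k * (2 * Real.pi) := by
    have := congrArg Complex.im hk
    simp at this
    linarith
  have hk0 : k = 0 := by
    rw [hk', abs_mul, abs_of_pos Real.two_pi_pos] at hlt
    have : |(k : ℝ)| < 1 := by nlinarith [Real.two_pi_pos]
    exact Int.abs_lt_one_iff.1 (by exact_mod_cast this)
  rw [hk0] at hk'
  simp at hk'
  linarith

/-- A weighted connected graph with weights in `{1,2,3,4}` has a length-preserving
realization on the line iff it has a realization on the circle of radius `r`
centered at the origin in which each edge `uv` is realized with chord length
`2r·sin(w(uv)·α/2)`, provided `0 < α < π/(2n)`. -/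
theorem line_iff_circle_realization {V : Type*} [Fintype V]
    (G : SimpleGraph V) (hconn : G.Connected) (hn : 1 ≤ Fintype.card V)
    (w : V → V → ℝ)
    (hw : ∀ u v, G.Adj u v → w u v = w v u ∧ w u v ∈ ({1, 2, 3, 4} : Set ℝ))
    (α r : ℝ) (hα0 : 0 < α) (hα : α < Real.pi / (2 * (Fintype.card V : ℝ)))
    (hr : 0 < r) :
    (∃ φ : V → ℝ, ∀ u v, G.Adj u v → |φ u - φ v| = w u v) ↔
      (∃ ψ : V → EuclideanSpace ℝ (Fin 2),
        (∀ u, ‖ψ u‖ = r) ∧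
        ∀ u v, G.Adj u v → ‖ψ u - ψ v‖ = 2 * r * Real.sin (w u v * α / 2)) := by
  have hn' : (0 : ℝ) < Fintype.card V := by exact_mod_cast hn
  have hαn : α * (2 * Fintype.card V) < Real.pi := (lt_div_iff₀ (by positivity)).1 hα
  have hedge : ∀ u v, G.Adj u v → 0 < w u v ∧ w u v ≤ 4 ∧ w u v * α < Real.pi := by
    intro u v h
    have hpos : 0 < w u v ∧ w u v ≤ 4 := by
      rcases (hw u v h).2 with e | e | e | e <;> rw [e] <;> norm_num
    have hcard : (2 : ℝ) ≤ Fintype.card V := by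
      exact_mod_cast Fintype.one_lt_card_iff.2 ⟨u, v, h.ne⟩
    exact ⟨hpos.1, hpos.2, by nlinarith⟩
  let e := Complex.orthonormalBasisOneI.repr
  constructor
  · rintro ⟨φ, hφ⟩
    have hr' : ∀ x : ℝ, ‖(r : ℂ) * Complex.exp (Complex.I * x)‖ = r := by
      intro x
      rw [norm_mul, mul_comm Complex.I, Complex.norm_exp_ofReal_mul_I, Complex.norm_real,
        Real.norm_of_nonneg hr.le, mul_one]
    refine ⟨fun u => e (r * Complex.exp (Complex.I * ((α * φ u : ℝ) : ℂ))), fun u => ?_,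
      fun u v h => ?_⟩
    · rw [LinearIsometryEquiv.norm_map, hr']
    · obtain ⟨-, -, h3⟩ := hedge u v h
      have habs : |α * φ v - α * φ u| = w u v * α := by
        rw [← mul_sub, abs_mul, abs_of_pos hα0, abs_sub_comm, hφ u v h, mul_comm]
      have hrot : (r : ℂ) * Complex.exp (Complex.I * ((α * φ v : ℝ) : ℂ)) =
          r * Complex.exp (Complex.I * ((α * φ u : ℝ) : ℂ)) *
            Complex.exp (Complex.I * ((α * φ v - α * φ u : ℝ) : ℂ)) := by
        rw [mul_assoc, ← Complex.exp_add]
        congr 2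
        push_cast
        ring
      rw [← map_sub, LinearIsometryEquiv.norm_map, hrot,
        Complex.norm_sub_mul_exp_I _ (by rw [habs]; linarith [Real.pi_pos]), hr', habs]
  · rintro ⟨ψ, hψr, hψ⟩
    let z : V → ℂ := fun u => e.symm (ψ u)
    have hzr : ∀ u, ‖z u‖ = r := fun u => by
      simp only [z, LinearIsometryEquiv.norm_map, hψr]
    have hz : ∀ u, z u ≠ 0 := fun u => norm_pos_iff.1 (by rw [hzr]; exact hr)
    let a : V → V → ℝ := fun u v => Complex.arg (z v / z u)
    have hza : ∀ u v, z v = z u * Complex.exp (Complex.I * a u v) := by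
      intro u v
      have h1 := Complex.norm_mul_exp_arg_mul_I (z v / z u)
      rw [norm_div, hzr, hzr, div_self hr.ne', Complex.ofReal_one, one_mul] at h1
      rw [mul_comm Complex.I, h1, mul_div_cancel₀ _ (hz u)]
    have ha : ∀ u v, G.Adj u v → |a u v| = w u v * α := by
      intro u v h
      obtain ⟨h1, -, h3⟩ := hedge u v h
      have hpi : |a u v| ≤ Real.pi := Complex.abs_arg_le_pi _
      have hc := Complex.norm_sub_mul_exp_I (z u) (a := a u v) (by linarith [Real.pi_pos])
      have hd : ‖z u - z v‖ = 2 * r * Real.sin (w u v * α / 2) := by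
        rw [← hψ u v h, ← map_sub, LinearIsometryEquiv.norm_map]
      rw [← hza u v, hd, hzr] at hc
      have hs := mul_left_cancel₀ (by positivity : 2 * r ≠ 0) hc
      have h0 := abs_nonneg (a u v)
      have hwa : 0 < w u v * α := mul_pos h1 hα0
      have := Real.injOn_sin ⟨by linarith, by linarith⟩ ⟨by linarith, by linarith⟩ hs
      linarith
    have hanti : ∀ u v, G.Adj u v → a v u = -a u v := by
      intro u v h
      have hne : Complex.arg (z v / z u) ≠ Real.pi := by
        intro hpi
        have := ha u v h
        simp only [a, hpi, abs_of_pos Real.pi_pos] at this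
        linarith [(hedge u v h).2.2]
      change Complex.arg (z u / z v) = -Complex.arg (z v / z u)
      rw [← inv_div, Complex.arg_inv, if_neg hne]
    obtain ⟨φ, hφ⟩ := hconn.exists_angle_potential z a (4 * α) hz (fun u v _ => hza u v) hanti
      (fun u v h => by
        rw [ha u v h]
        exact mul_le_mul_of_nonneg_right (hedge u v h).2.1 hα0.le)
      (by linarith)
    refine ⟨fun u => φ u / α, fun u v h => ?_⟩
    rw [← sub_div, abs_div, abs_of_pos hα0, abs_sub_comm, hφ u v h, ha u v h,
      mul_div_cancel_right₀ _ hα0.ne']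
end

section
/- Let d ∈ ℕ, let S be a finite set, and let p, q : S → ℝ^d satisfy ‖p(u) − p(v)‖ = ‖q(u) − q(v)‖ for all u, v ∈ S. Let B ⊆ S be such that the family (p(b))_{b∈B} is affinely independent, every point p(v) (v ∈ S) lies in the affine span of {p(b) : b ∈ B}, and p(b) = q(b) for all b ∈ B. Then p = q. -/
/-- Uniqueness-of-extension property of a metric basis: if two point families on `S`
in `ℝ^d` have equal pairwise distances, the points of `p` indexed by `B` are affinely
independent and affinely span all points of `p`, and `p` and `q` agree on `B`,
then `p = q`. -/
theorem realization_unique_of_basis (d : ℕ) {S : Type*} [Finite S]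
    (p q : S → EuclideanSpace ℝ (Fin d))
    (hpq : ∀ u v : S, dist (p u) (p v) = dist (q u) (q v))
    (B : Set S)
    (hind : AffineIndependent ℝ (fun b : B => p ↑b))
    (hspan : ∀ v : S, p v ∈ affineSpan ℝ (p '' B))
    (heq : ∀ b ∈ B, p b = q b) :
    p = q := by
  ext1 v
  have hB : affineSpan ℝ (p '' B) ≤ AffineSubspace.perpBisector (p v) (q v) := by
    rw [affineSpan_le]
    rintro _ ⟨b, hb, rfl⟩
    rw [SetLike.mem_coe, AffineSubspace.mem_perpBisector_iff_dist_eq, hpq b v, heq b hb]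
  exact AffineSubspace.left_mem_perpBisector.mp (hB (hspan v))
end

section
/- (Blumenthal's Cayley–Menger characterization.) Let d ≥ 1 and let (X, ρ) be a finite distance space with n points. Then (X, ρ) is strongly d-embeddable if and only if there exist d+1 distinct points x₀, x₁, …, x_d ∈ X such that: (1) (−1)^{j+1}·CM(x₀, x₁, …, x_j) > 0 for every 1 ≤ j ≤ d; and (2) for all x, y ∈ X \ {x₀,…,x_d}, CM(x₀, …, x_d, x) = 0, CM(x₀, …, x_d, y) = 0, and CM(x₀, …, x_d, x, y) = 0. -/
/-- The Cayley–Menger determinant of the points `x 0, …, x (m−1)` of the distance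
space `(X, ρ)`: the determinant of the matrix whose extra (`none`) row and column are
`(0,1,…,1)` and whose remaining entries are the squared distances `ρ(x_a, x_b)²`. -/
noncomputable def CayleyMenger {X : Type*} (ρ : X → X → ℝ) {m : ℕ}
    (x : Fin m → X) : ℝ :=
  Matrix.det (Matrix.of fun i j : Option (Fin m) =>
    match i, j with
    | none, none => 0
    | none, some _ => 1
    | some _, none => 1
    | some a, some b => ρ (x a) (x b) ^ 2)

/-- The distance space `(X, ρ)` is isometrically embeddable into `ℝ^d`
(the embedding need not be injective). -/
def Embeddable (d : ℕ) {X : Type*} (ρ : X → X → ℝ) : Prop :=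
  ∃ φ : X → EuclideanSpace ℝ (Fin d), ∀ x y, dist (φ x) (φ y) = ρ x y

open Matrix

/-- The inner product `⟪a - p, b - p⟫` expressed through the distances `ρ`. -/
noncomputable def basedInner {X : Type*} (ρ : X → X → ℝ) (p a b : X) : ℝ :=
  (ρ p a ^ 2 + ρ p b ^ 2 - ρ a b ^ 2) / 2

/-- The matrix of values `k (v i) (w j)` of a kernel `k`. -/
def kernelMatrix {X ι κ : Type*} (k : X → X → ℝ) (v : ι → X) (w : κ → X) : Matrix ι κ ℝ :=
  Matrix.of fun i j => k (v i) (w j)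

/-- The Schur complement of a kernel with respect to finitely many points. -/
noncomputable def kernelSchur {X ι : Type*} [Fintype ι] [DecidableEq ι] (k : X → X → ℝ)
    (v : ι → X) (a b : X) : ℝ :=
  k a b - (fun i => k a (v i)) ⬝ᵥ (kernelMatrix k v v)⁻¹ *ᵥ fun i => k (v i) b

/-- The border of a Cayley–Menger matrix and its first point, followed by the other points. -/
noncomputable def borderEquiv (m : ℕ) : Fin 2 ⊕ Fin m ≃ Option (Fin (m + 1)) :=
  Equiv.ofBijective (Sum.elim ![none, some 0] fun i => some i.succ) <| by
    constructor
    · rintro (a | a) (b | b)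
      · fin_cases a <;> fin_cases b <;> simp
      · fin_cases a <;> simp [(Fin.succ_ne_zero b).symm]
      · fin_cases b <;> simp [Fin.succ_ne_zero a]
      · simp
    · rintro (_ | a)
      · exact ⟨.inl 0, rfl⟩
      · refine a.cases ⟨.inl 1, rfl⟩ fun i => ⟨.inr i, rfl⟩

@[simp]
theorem borderEquiv_inl_zero (m : ℕ) : borderEquiv m (.inl 0) = none := rfl

@[simp]
theorem borderEquiv_inl_one (m : ℕ) : borderEquiv m (.inl 1) = some 0 := rfl

@[simp]
theorem borderEquiv_inr (m : ℕ) (i : Fin m) : borderEquiv m (.inr i) = some i.succ := rfl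

theorem cayleyMenger_cons {X : Type*} (ρ : X → X → ℝ) (hsymm : ∀ x y, ρ x y = ρ y x)
    (hzero : ∀ x, ρ x x = 0) {m : ℕ} (p : X) (v : Fin m → X) :
    CayleyMenger ρ (Fin.cons p v : Fin (m + 1) → X) =
      -(-2) ^ m * (kernelMatrix (basedInner ρ p) v v).det := by
  let A : Matrix (Fin 2) (Fin 2) ℝ := !![0, 1; 1, 0]
  let B : Matrix (Fin 2) (Fin m) ℝ := Matrix.of ![fun _ => 1, fun j => ρ p (v j) ^ 2]
  have hA : A * A = 1 := by
    ext i j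
    fin_cases i <;> fin_cases j <;> simp [A, Matrix.mul_apply]
  let : Invertible A := ⟨A, hA, hA⟩
  have hblock : CayleyMenger ρ (Fin.cons p v : Fin (m + 1) → X) =
      (fromBlocks A B Bᵀ (Matrix.of fun i j => ρ (v i) (v j) ^ 2)).det := by
    rw [CayleyMenger, ← det_submatrix_equiv_self (borderEquiv m)]
    congr 1
    ext (i | i) (j | j)
    · fin_cases i <;> fin_cases j <;> simp [A, hzero]
    · fin_cases i <;> simp [B]
    · fin_cases j <;> simp [B, hsymm (v i) p]
    · simp
  have hschur : (Matrix.of fun i j => ρ (v i) (v j) ^ 2) - Bᵀ * ⅟A * B =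
      (-2 : ℝ) • kernelMatrix (basedInner ρ p) v v := by
    change (Matrix.of fun i j => ρ (v i) (v j) ^ 2) - Bᵀ * A * B = _
    ext i j
    simp [Matrix.mul_apply, Fin.sum_univ_two, A, B, kernelMatrix, basedInner]
    ring
  rw [hblock, det_fromBlocks₁₁, hschur, det_smul]
  simp [A, det_fin_two]

theorem cayleyMenger_eq_zero_of_not_injective {X : Type*} (ρ : X → X → ℝ) {m : ℕ}
    {x : Fin m → X} (hx : ¬ Function.Injective x) : CayleyMenger ρ x = 0 := by
  obtain ⟨i, j, hij, hne⟩ := Function.not_injective_iff.mp hx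
  refine det_zero_of_row_eq (i := some i) (j := some j) (by simpa using hne) ?_
  ext (_ | k) <;> simp [hij]

theorem basedInner_comm {X : Type*} {ρ : X → X → ℝ} (hsymm : ∀ x y, ρ x y = ρ y x)
    (p a b : X) : basedInner ρ p a b = basedInner ρ p b a := by
  simp only [basedInner, hsymm a b]
  ring

theorem kernelSchur_comm {X ι : Type*} [Fintype ι] [DecidableEq ι] {k : X → X → ℝ}
    (hk : ∀ a b, k a b = k b a) (v : ι → X) (a b : X) :
    kernelSchur k v a b = kernelSchur k v b a := by
  have hM : (kernelMatrix k v v)ᵀ = kernelMatrix k v v := by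
    ext i j
    exact hk _ _
  rw [kernelSchur, kernelSchur, hk a b, dotProduct_mulVec, dotProduct_comm, ← mulVec_transpose,
    transpose_nonsing_inv, hM]
  simp only [fun i => hk a (v i), fun i => hk b (v i)]

theorem det_kernelMatrix_append {X : Type*} (k : X → X → ℝ) {d l : ℕ} (v : Fin d → X)
    (y : Fin l → X) (hv : (kernelMatrix k v v).det ≠ 0) :
    (kernelMatrix k (Fin.append v y) (Fin.append v y)).det =
      (kernelMatrix k v v).det * (kernelMatrix (kernelSchur k v) y y).det := by
  let := invertibleOfIsUnitDet _ hv.isUnit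
  have hblock : (kernelMatrix k (Fin.append v y) (Fin.append v y)).submatrix
      finSumFinEquiv finSumFinEquiv = fromBlocks (kernelMatrix k v v) (kernelMatrix k v y)
        (kernelMatrix k y v) (kernelMatrix k y y) := by
    ext (i | i) (j | j) <;> simp [kernelMatrix]
  rw [← det_submatrix_equiv_self finSumFinEquiv, hblock, det_fromBlocks₁₁, invOf_eq_nonsing_inv]
  congr 2
  ext i j
  rw [Matrix.mul_assoc]
  rfl

/-- **Sylvester's criterion**: a real symmetric matrix with positive leading principal minors is
positive definite. -/
theorem posDef_of_leading_minors_pos {n : ℕ} (M : Matrix (Fin n) (Fin n) ℝ)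
    (hM : M.IsHermitian)
    (h : ∀ j, ∀ hj : j ≤ n, 0 < (M.submatrix (Fin.castLE hj) (Fin.castLE hj)).det) :
    M.PosDef := by
  induction n with
  | zero => exact .of_dotProduct_mulVec_pos hM fun x hx => (hx (Subsingleton.elim _ _)).elim
  | succ n ih =>
    let A := M.submatrix (Fin.castAdd 1) (Fin.castAdd 1)
    have hA : A.PosDef := ih A (hM.submatrix _) fun j hj => h j (hj.trans n.le_succ)
    let B := M.submatrix (Fin.castAdd 1) (Fin.natAdd (m := 1) n)
    let D := M.submatrix (Fin.natAdd (m := 1) n) (Fin.natAdd (m := 1) n)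
    let := hA.isUnit.invertible
    have hblock : M.submatrix finSumFinEquiv finSumFinEquiv = fromBlocks A B Bᴴ D := by
      ext (i | i) (j | j)
      · simp [A]
      · simp [B]
      · simpa [B] using (hM.apply _ _).symm
      · simp [D]
    have hdet : 0 < M.det := by simpa using h (n + 1) le_rfl
    have hschur : 0 < (D - Bᴴ * ⅟A * B).det := by
      rw [← det_submatrix_equiv_self finSumFinEquiv, hblock, det_fromBlocks₁₁] at hdet
      exact (mul_pos_iff_of_pos_left hA.det_pos).mp hdet
    have hpsd : (M.submatrix finSumFinEquiv finSumFinEquiv).PosSemidef := by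
      rw [hblock, hA.fromBlocks₁₁, ← invOf_eq_nonsing_inv]
      set S := D - Bᴴ * ⅟A * B
      have hS : S = diagonal fun _ => S.det := by
        ext i j
        fin_cases i
        fin_cases j
        simp
      rw [hS]
      exact .diagonal fun _ => hschur.le
    rw [posSemidef_submatrix_equiv] at hpsd
    exact hpsd.posDef_iff_det_ne_zero.mpr hdet.ne'

theorem basedInner_dist {X : Type*} {E : Type*} [NormedAddCommGroup E] [InnerProductSpace ℝ E]
    {ρ : X → X → ℝ} (φ : X → E) (hφ : ∀ x y, dist (φ x) (φ y) = ρ x y) (p a b : X) :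
    basedInner ρ p a b = inner ℝ (φ a - φ p) (φ b - φ p) := by
  have h := norm_sub_sq_real (φ a - φ p) (φ b - φ p)
  rw [sub_sub_sub_cancel_right] at h
  rw [basedInner, ← hφ, ← hφ, ← hφ, dist_comm (φ p), dist_comm (φ p), dist_eq_norm, dist_eq_norm,
    dist_eq_norm]
  linarith

theorem kernelMatrix_basedInner_eq_gram {X ι : Type*} {E : Type*} [NormedAddCommGroup E]
    [InnerProductSpace ℝ E] {ρ : X → X → ℝ} (φ : X → E)
    (hφ : ∀ x y, dist (φ x) (φ y) = ρ x y) (p : X) (v : ι → X) :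
    kernelMatrix (basedInner ρ p) v v = gram ℝ fun i => φ (v i) - φ p := by
  ext i j
  exact basedInner_dist φ hφ p _ _

theorem Embeddable.det_kernelMatrix_eq_zero {X : Type*} {ρ : X → X → ℝ} {d m : ℕ}
    (h : Embeddable d ρ) (hm : d < m) (p : X) (v : Fin m → X) :
    (kernelMatrix (basedInner ρ p) v v).det = 0 := by
  obtain ⟨φ, hφ⟩ := h
  rw [kernelMatrix_basedInner_eq_gram φ hφ]
  by_contra hne
  have := (linearIndependent_of_det_gram_ne_zero hne).fintype_card_le_finrank
  simp at this
  omega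

/-- If the based inner products agree with the kernel obtained by projecting to the span of `d`
points with positive definite Gram matrix, then the space embeds in dimension `d`. -/
theorem embeddable_of_kernelSchur_eq_zero {X : Type*} {ρ : X → X → ℝ} {d : ℕ}
    (hnn : ∀ x y, 0 ≤ ρ x y) (hsymm : ∀ x y, ρ x y = ρ y x) (hzero : ∀ x, ρ x x = 0)
    (p : X) (v : Fin d → X) (hpd : (kernelMatrix (basedInner ρ p) v v).PosDef)
    (h : ∀ a b, kernelSchur (basedInner ρ p) v a b = 0) : Embeddable d ρ := by
  obtain ⟨B, hB⟩ : ∃ B : Matrix (Fin d) (Fin d) ℝ,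
      kernelMatrix (basedInner ρ p) v v = Bᴴ * B := by
    open scoped MatrixOrder in
    exact CStarAlgebra.nonneg_iff_eq_star_mul_self.mp hpd.posSemidef.nonneg
  let φ : X → EuclideanSpace ℝ (Fin d) := fun a =>
    WithLp.toLp 2 ((Bᵀ)⁻¹ *ᵥ fun i => basedInner ρ p (v i) a)
  have hinner (a b : X) : inner ℝ (φ a) (φ b) = basedInner ρ p a b := by
    rw [sub_eq_zero.mp (h a b), hB, conjTranspose_eq_transpose_of_trivial, Matrix.mul_inv_rev,
      ← mulVec_mulVec, dotProduct_mulVec, real_inner_comm, ← mulVec_transpose,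
      transpose_nonsing_inv]
    simp [φ, EuclideanSpace.inner_eq_star_dotProduct, basedInner_comm hsymm p a]
  refine ⟨φ, fun a b => ?_⟩
  rw [dist_eq_norm, ← sq_eq_sq₀ (norm_nonneg _) (hnn a b), norm_sub_sq_real,
    ← real_inner_self_eq_norm_sq, ← real_inner_self_eq_norm_sq, hinner, hinner, hinner]
  simp only [basedInner, hzero]
  ring

theorem span_eq_top_of_not_embeddable {X : Type*} {ρ : X → X → ℝ} {n : ℕ}
    (φ : X → EuclideanSpace ℝ (Fin (n + 1))) (hφ : ∀ x y, dist (φ x) (φ y) = ρ x y)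
    (hnot : ¬ Embeddable n ρ) (p : X) :
    Submodule.span ℝ (Set.range fun a => φ a - φ p) = ⊤ := by
  by_contra hne
  have hperp : (Submodule.span ℝ (Set.range fun a => φ a - φ p))ᗮ ≠ ⊥ := by
    rwa [Ne, Submodule.orthogonal_eq_bot_iff]
  obtain ⟨u, hu, hu0⟩ := Submodule.exists_mem_ne_zero_of_ne_bot hperp
  have : Fact (Module.finrank ℝ (EuclideanSpace ℝ (Fin (n + 1))) = n + 1) := ⟨by simp⟩
  let b := OrthonormalBasis.fromOrthogonalSpanSingleton (𝕜 := ℝ) n hu0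
  have hmem (a : X) : φ a - φ p ∈ (Submodule.span ℝ {u})ᗮ := by
    rw [Submodule.mem_orthogonal_singleton_iff_inner_left]
    exact Submodule.inner_right_of_mem_orthogonal
      (Submodule.subset_span (Set.mem_range_self a)) hu
  refine hnot ⟨fun a => b.repr ⟨φ a - φ p, hmem a⟩, fun x y => ?_⟩
  rw [b.repr.dist_map, Subtype.dist_eq, dist_sub_right, hφ]

/-- A strongly embeddable space contains, for any base point, a family of points whose
displacements form a basis. -/
theorem exists_linearIndependent_of_not_embeddable {X : Type*} {ρ : X → X → ℝ} {n : ℕ}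
    (φ : X → EuclideanSpace ℝ (Fin (n + 1))) (hφ : ∀ x y, dist (φ x) (φ y) = ρ x y)
    (hnot : ¬ Embeddable n ρ) (p : X) :
    ∃ v : Fin (n + 1) → X, LinearIndependent ℝ fun i => φ (v i) - φ p := by
  obtain ⟨κ, a, -, hspan, hli⟩ := exists_linearIndependent' ℝ fun a => φ a - φ p
  rw [span_eq_top_of_not_embeddable φ hφ hnot p] at hspan
  let e := (Module.Basis.mk hli hspan.ge).indexEquiv (EuclideanSpace.basisFun _ ℝ).toBasis
  exact ⟨a ∘ e.symm, hli.comp _ e.symm.injective⟩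

/-- Blumenthal's Cayley–Menger characterization: a finite distance space is strongly
`d`-embeddable (i.e. `d`-embeddable but not `(d−1)`-embeddable) iff there are `d+1`
distinct points `x₀,…,x_d` with `(−1)^{j+1}·CM(x₀,…,x_j) > 0` for `1 ≤ j ≤ d`,
and `CM(x₀,…,x_d,x) = CM(x₀,…,x_d,y) = CM(x₀,…,x_d,x,y) = 0` for all remaining
points `x, y`. -/
theorem blumenthal_characterization {X : Type*} [Finite X] (d : ℕ) (hd : 1 ≤ d)
    (ρ : X → X → ℝ) (hnn : ∀ x y, 0 ≤ ρ x y)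
    (hsymm : ∀ x y, ρ x y = ρ y x) (hzero : ∀ x, ρ x x = 0) :
    (Embeddable d ρ ∧ ¬ Embeddable (d - 1) ρ) ↔
      ∃ x : Fin (d + 1) → X, Function.Injective x ∧
        (∀ j : ℕ, 1 ≤ j → ∀ hjd : j ≤ d,
          0 < (-1 : ℝ) ^ (j + 1) *
            CayleyMenger ρ (fun i : Fin (j + 1) => x (Fin.castLE (by omega) i))) ∧
        (∀ ξ υ : X, ξ ∉ Set.range x → υ ∉ Set.range x →
          CayleyMenger ρ (Fin.snoc x ξ) = 0 ∧
          CayleyMenger ρ (Fin.snoc x υ) = 0 ∧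
          CayleyMenger ρ (Fin.snoc (Fin.snoc x ξ) υ) = 0) := by
  obtain ⟨n, rfl⟩ : ∃ n, d = n + 1 := ⟨d - 1, by omega⟩
  rw [Nat.add_sub_cancel]
  have hprefix (p : X) (v : Fin (n + 1) → X) (j : ℕ) (hj : j ≤ n + 1) :
      (-1 : ℝ) ^ (j + 1) * CayleyMenger ρ (fun i : Fin (j + 1) =>
        (Fin.cons p v : Fin (n + 1 + 1) → X) (Fin.castLE (by omega) i)) =
      2 ^ j * ((kernelMatrix (basedInner ρ p) v v).submatrix
        (Fin.castLE hj) (Fin.castLE hj)).det := by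
    have hcons : (fun i : Fin (j + 1) =>
        (Fin.cons p v : Fin (n + 1 + 1) → X) (Fin.castLE (by omega) i)) =
        (Fin.cons p (v ∘ Fin.castLE hj) : Fin (j + 1) → X) := by
      funext i
      refine i.cases rfl fun i => rfl
    have hsign : (-1 : ℝ) ^ (j + 1) * -(-2) ^ j = 2 ^ j := by
      rw [pow_succ, mul_neg_one, neg_mul_neg, ← mul_pow]
      norm_num
    rw [hcons, cayleyMenger_cons ρ hsymm hzero, ← mul_assoc, hsign]
    rfl
  constructor
  · rintro ⟨hemb, hnot⟩
    obtain ⟨φ, hφ⟩ := id hemb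
    obtain ⟨p⟩ : Nonempty X := by
      by_contra hX
      rw [not_nonempty_iff] at hX
      exact hnot ⟨isEmptyElim, isEmptyElim⟩
    obtain ⟨v, hv⟩ := exists_linearIndependent_of_not_embeddable φ hφ hnot p
    have hpd : (kernelMatrix (basedInner ρ p) v v).PosDef := by
      rw [kernelMatrix_basedInner_eq_gram φ hφ]
      exact posDef_gram_of_linearIndependent hv
    refine ⟨Fin.cons p v, Fin.cons_injective_iff.mpr ⟨?_, ?_⟩, fun j _ hj => ?_, fun ξ υ _ _ => ?_⟩
    · rintro ⟨i, hi⟩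
      exact hv.ne_zero i (by simp [hi])
    · exact fun i j hij => hv.injective (by simp [hij])
    · rw [hprefix p v j hj]
      exact mul_pos (by positivity) (hpd.submatrix (Fin.castLE_injective hj)).det_pos
    · simp only [← Fin.cons_snoc_eq_snoc_cons, cayleyMenger_cons ρ hsymm hzero]
      refine ⟨?_, ?_, ?_⟩ <;> rw [hemb.det_kernelMatrix_eq_zero (by omega), mul_zero]
  · rintro ⟨x, -, hpos, hvanish⟩
    obtain ⟨p, v, rfl⟩ : ∃ p v, x = Fin.cons p v := ⟨x 0, Fin.tail x, (Fin.cons_self_tail x).symm⟩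
    have hminor (j : ℕ) (hj : j ≤ n + 1) : 0 < ((kernelMatrix (basedInner ρ p) v v).submatrix
        (Fin.castLE hj) (Fin.castLE hj)).det := by
      obtain rfl | hj0 := j.eq_zero_or_pos
      · simp
      · have := hpos j hj0 hj
        rw [hprefix p v j hj] at this
        exact (mul_pos_iff_of_pos_left (by positivity)).mp this
    have hpd : (kernelMatrix (basedInner ρ p) v v).PosDef := by
      refine posDef_of_leading_minors_pos _ ?_ hminor
      ext i j
      exact basedInner_comm hsymm p _ _
    have hdet := hpd.det_pos.ne'
    refine ⟨?_, fun hemb => hdet (hemb.det_kernelMatrix_eq_zero n.lt_succ_self p v)⟩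
    have hone (a : X) : CayleyMenger ρ (Fin.snoc (Fin.cons p v : Fin (n + 1 + 1) → X) a) = 0 := by
      by_cases ha : a ∈ Set.range (Fin.cons p v : Fin (n + 1 + 1) → X)
      · exact cayleyMenger_eq_zero_of_not_injective ρ fun h => (Fin.snoc_injective_iff.mp h).2 ha
      · exact (hvanish a a ha ha).1
    have htwo (a b : X) : CayleyMenger ρ
        (Fin.snoc (Fin.snoc (Fin.cons p v : Fin (n + 1 + 1) → X) a : Fin (n + 1 + 1 + 1) → X) b) =
          0 := by
      by_cases ha : a ∈ Set.range (Fin.cons p v : Fin (n + 1 + 1) → X)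
      · exact cayleyMenger_eq_zero_of_not_injective ρ fun h =>
          (Fin.snoc_injective_iff.mp (Fin.snoc_injective_iff.mp h).1).2 ha
      by_cases hb : b ∈ Set.range (Fin.cons p v : Fin (n + 1 + 1) → X)
      · refine cayleyMenger_eq_zero_of_not_injective ρ fun h =>
          (Fin.snoc_injective_iff.mp h).2 ?_
        obtain ⟨i, hi⟩ := hb
        exact ⟨i.castSucc, by rw [Fin.snoc_castSucc, hi]⟩
      · exact (hvanish a b ha hb).2.2
    have hdiag (a : X) : kernelSchur (basedInner ρ p) v a a = 0 := by
      have h := hone a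
      rw [← Fin.cons_snoc_eq_snoc_cons, cayleyMenger_cons ρ hsymm hzero,
        ← Fin.append_right_eq_snoc v fun _ => a, det_kernelMatrix_append _ _ _ hdet] at h
      rw [mul_eq_zero_iff_left (by simp), mul_eq_zero_iff_left hdet] at h
      simpa [kernelMatrix] using h
    refine embeddable_of_kernelSchur_eq_zero hnn hsymm hzero p v hpd fun a b => ?_
    have h := htwo a b
    rw [← Fin.cons_snoc_eq_snoc_cons, ← Fin.cons_snoc_eq_snoc_cons,
      cayleyMenger_cons ρ hsymm hzero, ← Fin.append_right_eq_snoc v fun _ => a,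
      ← Fin.append_snoc, det_kernelMatrix_append _ _ _ hdet] at h
    rw [mul_eq_zero_iff_left (by simp), mul_eq_zero_iff_left hdet] at h
    have hsq : kernelSchur (basedInner ρ p) v a b * kernelSchur (basedInner ρ p) v a b = 0 := by
      simpa [kernelMatrix, det_fin_two, Fin.snoc, hdiag,
        kernelSchur_comm (basedInner_comm hsymm p) v b a] using h
    exact mul_self_eq_zero.mp hsq
end
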